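/- Let R be a commutative Noetherian ring and 𝔞 an ideal of R with dim R/𝔞 ≤ 1 (the Krull dimension of the ring R/𝔞 is at most 1). Then for any R-module M, the local cohomology module H^i_𝔞(M) is 𝔞-cofinite for all i ≥ 0 if and only if Ext^i_R(R/𝔞, M) is a finitely generated R-module for all i ≥ 0. -/

import Mathlib

universe u

open CategoryTheory

/-- The `i`-th Ext module `Ext^i_R(N, M)`. -/
noncomputable def extModule (R : Type u) [CommRing R] (N M : Type u)
    [AddCommGroup N] [Module R N] [AddCommGroup M] [Module R M] (i : ℕ) :
    ModuleCat.{u} R :=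
  ((Ext R (ModuleCat.{u} R) i).obj (Opposite.op (ModuleCat.of R N))).obj (ModuleCat.of R M)

/-- The `i`-th local cohomology module `H^i_𝔞(M)`. -/
noncomputable def localCohomologyModule (R : Type u) [CommRing R] (𝔞 : Ideal R)
    (M : Type u) [AddCommGroup M] [Module R M] (i : ℕ) : ModuleCat.{u} R :=
  (localCohomology 𝔞 i).obj (ModuleCat.of R M)

/-- An `R`-module `M` is `𝔞`-cofinite if `Supp M ⊆ V(𝔞)` and all the modules
`Ext^i_R(R/𝔞, M)` are finitely generated. -/
def IsCofinite (R : Type u) [CommRing R] (𝔞 : Ideal R)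
    (M : Type u) [AddCommGroup M] [Module R M] : Prop :=
  Module.support R M ⊆ PrimeSpectrum.zeroLocus (𝔞 : Set R) ∧
    ∀ i : ℕ, Module.Finite R (extModule R (R ⧸ 𝔞) M i)

/-- An `R`-module `M` is `FD_{<n}` if it has a finitely generated submodule `N` such that
the (Krull) dimension of the support of `M/N` is `< n`. -/
def IsFDLT (R : Type u) [CommRing R] (n : ℕ)
    (M : Type u) [AddCommGroup M] [Module R M] : Prop :=
  ∃ N : Submodule R M, N.FG ∧
    Order.krullDim (Module.support R (M ⧸ N)) < ((n : ℕ∞) : WithBot ℕ∞)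

universe w v

section

open Limits

namespace CategoryTheory.ProjectiveResolution

variable {R : Type w} [CommRing R] {C : Type u} [Category.{v} C] [Abelian C] [Linear R C]

/-- Precomposition with a morphism of complexes. -/
noncomputable def linearYonedaObjMap (R : Type w) [CommRing R] [Linear R C]
    {K L : ChainComplex C ℕ} (φ : K ⟶ L) (Y : C) :
    L.linearYonedaObj R Y ⟶ K.linearYonedaObj R Y :=
  (HomologicalComplex.unopFunctor _ _).map
    ((((linearYoneda R C).obj Y).rightOp.mapHomologicalComplex _).map φ).op

lemma homologyMap_opFunctor_map_unop_comp {D ι : Type*} [Category* D] [Abelian D]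
    {c : ComplexShape ι} {K L : HomologicalComplex D c} (ψ : K ⟶ L) (n : ι) :
    (HomologicalComplex.homologyMap
      ((HomologicalComplex.opFunctor D c).map ψ.op) n).unop ≫ (L.homologyOp n).inv.unop =
      (K.homologyOp n).inv.unop ≫ HomologicalComplex.homologyMap ψ n := by
  exact congrArg Quiver.Hom.unop
    (CommSq.mk (HomologicalComplex.homologyOp_hom_naturality ψ n).symm).horiz_inv.w

lemma map_comp_isoExt_hom [EnoughProjectives C] {X X' : C} (f : X ⟶ X') (P : ProjectiveResolution X)
    (Q : ProjectiveResolution X') (φ : P.complex ⟶ Q.complex)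
    (comm : φ.f 0 ≫ Q.π.f 0 = P.π.f 0 ≫ f) (n : ℕ) (Y : C) :
    ((Ext R C n).map f.op).app Y ≫ (P.isoExt n Y).hom =
      (Q.isoExt n Y).hom ≫
        HomologicalComplex.homologyMap (linearYonedaObjMap R φ Y) n := by
  have h := isoLeftDerivedObj_inv_naturality f P Q φ comm ((linearYoneda R C).obj Y).rightOp n
  have h2 := congrArg Quiver.Hom.unop h
  have h3 := congrArg Quiver.Hom.unop
    (HomologicalComplex.homologyOp_hom_naturality (linearYonedaObjMap R φ Y) n)
  have h4 := homologyMap_opFunctor_map_unop_comp (linearYonedaObjMap R φ Y) n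
  change ((((linearYoneda R C).obj Y).rightOp.leftDerived n).map f).unop ≫
      (P.isoLeftDerivedObj _ n).inv.unop ≫ _ = (_ ≫ _) ≫ _
  refine (congrArg (· ≫ ((P.complex.linearYonedaObj R Y).homologyOp n).inv.unop) h2).trans ?_
  exact (Category.assoc _ _ _).trans ((congrArg _ h4).trans (Category.assoc _ _ _).symm)

section

variable {X Y : C} (P : ProjectiveResolution X) (n : ℕ)

/-- The underlying cochain of a cocycle of `Hom(P, Y)`. -/
noncomputable def cyclesι (R : Type w) [CommRing R] [Linear R C] :
    (P.complex.linearYonedaObj R Y).cycles n →ₗ[R] (P.complex.X n ⟶ Y) :=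
  ((P.complex.linearYonedaObj R Y).iCycles n).hom

lemma cyclesι_injective : Function.Injective (P.cyclesι (Y := Y) n R) :=
  (ModuleCat.mono_iff_injective ((P.complex.linearYonedaObj R Y).iCycles n)).1 inferInstance

lemma d_comp_cyclesι (z : (P.complex.linearYonedaObj R Y).cycles n) :
    P.complex.d (n + 1) n ≫ P.cyclesι n R z = 0 :=
  congrArg (fun f ↦ f.hom z) ((P.complex.linearYonedaObj R Y).iCycles_d n (n + 1))

lemma exists_cyclesι_eq (f : P.complex.X n ⟶ Y) (hf : P.complex.d (n + 1) n ≫ f = 0) :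
    ∃ z, P.cyclesι n R z = f :=
  (ShortComplex.moduleCat_exact_iff _).1 (ShortComplex.exact_of_f_is_kernel
    (ShortComplex.mk _ _ ((P.complex.linearYonedaObj R Y).iCycles_d n (n + 1)))
    ((P.complex.linearYonedaObj R Y).cyclesIsKernel n (n + 1) (by simp))) f hf

end

variable [HasExt.{v} C]

lemma extMk_smul {X Y : C} (P : ProjectiveResolution X) {n : ℕ} (r : R)
    (f : P.complex.X n ⟶ Y) (m : ℕ) (hm : n + 1 = m) (hf : P.complex.d m n ≫ f = 0) :
    P.extMk (r • f) m hm (by simp [hf]) = r • P.extMk f m hm hf := by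
  rw [Abelian.Ext.smul_eq_comp_mk₀, extMk_comp_mk₀]
  congr 1
  simp

lemma extMk_eq_zero_iff_of_degree_zero {X Y : C} (P : ProjectiveResolution X)
    (f : P.complex.X 0 ⟶ Y) (m : ℕ) (hm : 0 + 1 = m) (hf : P.complex.d m 0 ≫ f = 0) :
    P.extMk f m hm hf = 0 ↔ f = 0 := by
  refine ⟨fun h ↦ ?_, fun h ↦ by subst h; simp⟩
  simp only [← P.extEquivCohomologyClass.apply_eq_iff_eq,
    extEquivCohomologyClass_extMk, extEquivCohomologyClass_zero,
    CochainComplex.HomComplex.CohomologyClass.mk_eq_zero_iff] at h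
  rw [CochainComplex.HomComplex.Cocycle.toSingleMk_mem_coboundaries_iff _ _ _ _ _ 1 (by lia)] at h
  obtain ⟨g, hg⟩ := h
  have hz : Limits.IsZero (P.cochainComplex.X 1) :=
    P.cochainComplex.isZero_of_isStrictlyLE 0 1 (by lia)
  rw [hz.eq_of_src g 0, comp_zero] at hg
  rw [← cancel_epi (P.cochainComplexXIso (-((0 : ℕ) : ℤ)) 0 rfl).hom, ← hg, comp_zero]

section

variable {X Y : C} (P : ProjectiveResolution X) (n : ℕ)

variable (R) in
/-- The class of a cocycle of `Hom(P, Y)` in `Ext X Y n`. -/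
noncomputable def cyclesToExt :
    (P.complex.linearYonedaObj R Y).cycles n →ₗ[R] Abelian.Ext X Y n where
  toFun z := P.extMk (P.cyclesι n R z) (n + 1) rfl (d_comp_cyclesι P n z)
  map_add' z z' := by simp only [map_add, add_extMk]
  map_smul' r z := by
    simp only [map_smul]
    exact P.extMk_smul r _ _ _ (d_comp_cyclesι P n z)

lemma cyclesToExt_apply (z : (P.complex.linearYonedaObj R Y).cycles n) :
    P.cyclesToExt R n z = P.extMk (P.cyclesι n R z) (n + 1) rfl (d_comp_cyclesι P n z) := rfl

lemma cyclesToExt_surjective : Function.Surjective (P.cyclesToExt (Y := Y) R n) := by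
  intro x
  obtain ⟨f, hf, rfl⟩ := P.extMk_surjective x (n + 1) rfl
  obtain ⟨z, rfl⟩ := P.exists_cyclesι_eq (R := R) n f hf
  exact ⟨z, rfl⟩

lemma toCycles_cyclesToExt (m : ℕ) :
    (P.complex.linearYonedaObj R Y).toCycles m n ≫ ModuleCat.ofHom (P.cyclesToExt R n) = 0 := by
  by_cases h : m + 1 = n
  · ext g
    change P.cyclesToExt R n _ = 0
    rw [cyclesToExt_apply, extMk_eq_zero_iff _ _ _ _ _ m h]
    exact ⟨g, (congrArg (fun f ↦ f.hom g)
      ((P.complex.linearYonedaObj R Y).toCycles_i m n)).symm⟩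
  · rw [HomologicalComplex.toCycles_eq_zero _ (by simpa using h)]
    exact zero_comp

lemma exists_toCycles_eq (z : (P.complex.linearYonedaObj R Y).cycles n)
    (hz : P.cyclesToExt R n z = 0) :
    ∃ m g, ((P.complex.linearYonedaObj R Y).toCycles m n).hom g = z := by
  rw [cyclesToExt_apply] at hz
  cases n with
  | zero =>
    rw [extMk_eq_zero_iff_of_degree_zero] at hz
    exact ⟨0, 0, P.cyclesι_injective 0 (by rw [map_zero, map_zero, hz])⟩
  | succ n =>
    rw [extMk_eq_zero_iff _ _ _ _ _ n rfl] at hz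
    obtain ⟨g, hg⟩ := hz
    exact ⟨n, g, P.cyclesι_injective _ ((congrArg (fun f ↦ f.hom g)
      ((P.complex.linearYonedaObj R Y).toCycles_i n (n + 1))).trans hg)⟩

/-- The comparison map from the cohomology of `Hom(P, Y)` to `Ext X Y n`. -/
noncomputable def homologyToExt :
    (P.complex.linearYonedaObj R Y).homology n ⟶ ModuleCat.of R (Abelian.Ext X Y n) :=
  ((P.complex.linearYonedaObj R Y).homologyIsCokernel _ n rfl).desc
    (CokernelCofork.ofπ (ModuleCat.ofHom (P.cyclesToExt R n)) (P.toCycles_cyclesToExt n _))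

lemma homologyπ_homologyToExt :
    (P.complex.linearYonedaObj R Y).homologyπ n ≫ P.homologyToExt n =
      ModuleCat.ofHom (P.cyclesToExt R n) :=
  ((P.complex.linearYonedaObj R Y).homologyIsCokernel _ n rfl).fac _ WalkingParallelPair.one

lemma homologyπ_homologyToExt_assoc {Z : ModuleCat R}
    (g : ModuleCat.of R (Abelian.Ext X Y n) ⟶ Z) :
    (P.complex.linearYonedaObj R Y).homologyπ n ≫ P.homologyToExt n ≫ g =
      ModuleCat.ofHom (P.cyclesToExt R n) ≫ g := by
  rw [← Category.assoc, homologyπ_homologyToExt]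

instance : IsIso (P.homologyToExt (R := R) (Y := Y) n) := by
  rw [ConcreteCategory.isIso_iff_bijective]
  let K := P.complex.linearYonedaObj R Y
  have hfac (z) : (P.homologyToExt n).hom ((K.homologyπ n).hom z) = P.cyclesToExt R n z :=
    congrArg (fun f ↦ f.hom z) (P.homologyπ_homologyToExt n)
  have hπ : Function.Surjective (K.homologyπ n).hom :=
    (ModuleCat.epi_iff_surjective _).1 inferInstance
  constructor
  · refine (injective_iff_map_eq_zero (P.homologyToExt (R := R) (Y := Y) n).hom).2 fun x hx ↦ ?_
    obtain ⟨z, rfl⟩ := hπ x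
    obtain ⟨m, g, rfl⟩ := P.exists_toCycles_eq n z ((hfac z).symm.trans hx)
    exact congrArg (fun f ↦ f.hom g) (K.toCycles_comp_homologyπ m n)
  · intro x
    obtain ⟨z, rfl⟩ := P.cyclesToExt_surjective (R := R) n x
    exact ⟨_, hfac z⟩

end

lemma homologyMap_comp_homologyToExt {X X' : C} {f : X ⟶ X'} {P : ProjectiveResolution X}
    {Q : ProjectiveResolution X'} (φ : Hom P Q f) (n : ℕ) (Y : C) :
    HomologicalComplex.homologyMap (linearYonedaObjMap R φ.hom Y) n ≫ P.homologyToExt n =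
      Q.homologyToExt n ≫ ModuleCat.ofHom ((Abelian.Ext.bilinearCompOfLinear R X X' Y 0 n n
        (zero_add n)) (Abelian.Ext.mk₀ f)) := by
  rw [← cancel_epi ((Q.complex.linearYonedaObj R Y).homologyπ n),
    HomologicalComplex.homologyπ_naturality_assoc, homologyπ_homologyToExt,
    homologyπ_homologyToExt_assoc]
  ext z
  change P.cyclesToExt R n _ = (Abelian.Ext.mk₀ f).comp (Q.cyclesToExt R n z) (zero_add _)
  rw [cyclesToExt_apply, cyclesToExt_apply]
  rw [mk₀_comp_extMk _ _ _ _ φ]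
  congr 1
  exact congrArg (fun f ↦ f.hom z)
    (HomologicalComplex.cyclesMap_i (linearYonedaObjMap R φ.hom Y) n)

end CategoryTheory.ProjectiveResolution

namespace CategoryTheory

variable {R : Type w} [CommRing R] {C : Type u} [Category.{v} C] [Abelian C] [Linear R C]
  [HasExt.{v} C] [EnoughProjectives C]

variable (R) in
/-- Comparison between the two definitions of Ext. -/
noncomputable def extObjObjIso (X Y : C) (n : ℕ) :
    ((Ext R C n).obj (Opposite.op X)).obj Y ≅ ModuleCat.of R (Abelian.Ext X Y n) :=
  (projectiveResolution X).isoExt n Y ≪≫ asIso ((projectiveResolution X).homologyToExt n)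

lemma extObjObjIso_naturality {X X' : C} (f : X ⟶ X') (Y : C) (n : ℕ) :
    ((Ext R C n).map f.op).app Y ≫ (extObjObjIso R X Y n).hom =
      (extObjObjIso R X' Y n).hom ≫ ModuleCat.ofHom
        ((Abelian.Ext.bilinearCompOfLinear R X X' Y 0 n n (zero_add n)) (Abelian.Ext.mk₀ f)) := by
  let φ : ProjectiveResolution.Hom (projectiveResolution X) (projectiveResolution X') f :=
    { hom := ProjectiveResolution.lift f _ _
      hom_f_zero_comp_π_f_zero := by
        simpa using ProjectiveResolution.lift_commutes_zero f _ _ }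
  rw [extObjObjIso, Iso.trans_hom, ← Category.assoc,
    ProjectiveResolution.map_comp_isoExt_hom f _ _ φ.hom
    (ProjectiveResolution.lift_commutes_zero f _ _), extObjObjIso]
  simp only [asIso_hom, Iso.trans_hom, Category.assoc]
  rw [ProjectiveResolution.homologyMap_comp_homologyToExt φ]

end CategoryTheory

end

section

lemma Module.DirectLimit.lift_bijective {R : Type*} [CommRing R] {G : ℕ → Type*}
    [∀ n, AddCommGroup (G n)] [∀ n, Module R (G n)] {f : ∀ n m, n ≤ m → G n →ₗ[R] G m}
    {P : Type*} [AddCommGroup P] [Module R P] (g : ∀ n, G n →ₗ[R] P)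
    (hg : ∀ i j hij x, g j (f i j hij x) = g i x) (hsurj : ∀ p, ∃ n x, g n x = p)
    (hinj : ∀ n x, g n x = 0 → ∃ m, ∃ h : n ≤ m, f n m h x = 0) :
    Function.Bijective (Module.DirectLimit.lift R ℕ G f g hg) := by
  constructor
  · refine (injective_iff_map_eq_zero _).2 fun z hz ↦ ?_
    obtain ⟨n, x, rfl⟩ := Module.DirectLimit.exists_of z
    rw [Module.DirectLimit.lift_of] at hz
    obtain ⟨m, h, hx⟩ := hinj n x hz
    rw [← Module.DirectLimit.of_f (hij := h), hx, map_zero]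
  · intro p
    obtain ⟨n, x, rfl⟩ := hsurj p
    exact ⟨Module.DirectLimit.of R ℕ G f n x, Module.DirectLimit.lift_of g hg x⟩

namespace localCohomology

variable {R : Type u} [CommRing R] (𝔞 : Ideal R)

/-- The quotient `R ⧸ 𝔞 ^ n`. -/
abbrev quotPow (n : ℕ) : ModuleCat.{u} R := ModuleCat.of R (R ⧸ 𝔞 ^ n)

/-- The projection `R ⧸ 𝔞 ^ m ⟶ R ⧸ 𝔞 ^ n` for `n ≤ m`. -/
def quotPowMap {n m : ℕ} (h : n ≤ m) : quotPow 𝔞 m ⟶ quotPow 𝔞 n :=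
  (ringModIdeals (idealPowersDiagram 𝔞)).map (homOfLE h).op

/-- The transition maps of the system `Ext (R ⧸ 𝔞 ^ n) M i`. -/
noncomputable def extPowMap (M : ModuleCat.{u} R) (i n m : ℕ) (h : n ≤ m) :
    Abelian.Ext (quotPow 𝔞 n) M i →ₗ[R] Abelian.Ext (quotPow 𝔞 m) M i :=
  Abelian.Ext.bilinearCompOfLinear R _ _ _ 0 i i (zero_add i)
    (Abelian.Ext.mk₀ (quotPowMap 𝔞 h))

lemma extPowMap_apply (M : ModuleCat.{u} R) {i n m : ℕ} (h : n ≤ m)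
    (x : Abelian.Ext (quotPow 𝔞 n) M i) :
    extPowMap 𝔞 M i n m h x = (Abelian.Ext.mk₀ (quotPowMap 𝔞 h)).comp x (zero_add i) := rfl

lemma extPowMap_comp {M N : ModuleCat.{u} R} {i j k n m : ℕ} (h : n ≤ m)
    (x : Abelian.Ext (quotPow 𝔞 n) M i) (y : Abelian.Ext M N j) (hk : i + j = k) :
    (extPowMap 𝔞 M i n m h x).comp y hk = extPowMap 𝔞 N k n m h (x.comp y hk) :=
  Abelian.Ext.comp_assoc _ _ _ (zero_add i) _ (by lia)

lemma extPowMap_extPowMap (M : ModuleCat.{u} R) {i n m k : ℕ} (h : n ≤ m) (h' : m ≤ k)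
    (x : Abelian.Ext (quotPow 𝔞 n) M i) :
    extPowMap 𝔞 M i m k h' (extPowMap 𝔞 M i n m h x) = extPowMap 𝔞 M i n k (h.trans h') x := by
  have : quotPowMap 𝔞 (h.trans h') = quotPowMap 𝔞 h' ≫ quotPowMap 𝔞 h :=
    (ringModIdeals (idealPowersDiagram 𝔞)).map_comp (homOfLE h').op (homOfLE h).op
  rw [extPowMap_apply, extPowMap_apply, extPowMap_apply, this, ← Abelian.Ext.mk₀_comp_mk₀,
    Abelian.Ext.comp_assoc _ _ _ _ _ (by lia)]

/-- The direct limit of the modules `Ext (R ⧸ 𝔞 ^ n) M i`. -/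
abbrev ExtLimit (M : ModuleCat.{u} R) (i : ℕ) : Type u :=
  Module.DirectLimit (fun n ↦ Abelian.Ext (quotPow 𝔞 n) M i) (extPowMap 𝔞 M i)

theorem nonempty_extLimit_equiv (M : ModuleCat.{u} R) (i : ℕ) :
    Nonempty (ExtLimit 𝔞 M i ≃ₗ[R] (localCohomology 𝔞 i).obj M) := by
  let F := diagram (idealPowersDiagram 𝔞) i ⋙ (evaluation _ _).obj M
  have : Limits.PreservesFilteredColimitsOfSize.{0, 0} (forget (ModuleCat.{u} R)) :=
    Limits.preservesSmallestFilteredColimits_of_preservesFilteredColimits.{u, u} _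
  let e : (localCohomology 𝔞 i).obj M ≅ Limits.colimit F :=
    Limits.colimitObjIsoColimitCompEvaluation _ _
  let c (n : ℕ) : F.obj (.op (.op n)) ≅ ModuleCat.of R (Abelian.Ext (quotPow 𝔞 n) M i) :=
    extObjObjIso R _ _ _
  let φ (n m : ℕ) (h : n ≤ m) : F.obj (.op (.op n)) ⟶ F.obj (.op (.op m)) :=
    F.map (homOfLE h).op.op
  have hc (n m : ℕ) (h : n ≤ m) (x) :
      extPowMap 𝔞 M i n m h ((c n).hom.hom x) = (c m).hom.hom ((φ n m h).hom x) :=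
    (congrArg (fun f ↦ f.hom x) (extObjObjIso_naturality (quotPowMap 𝔞 h) M i)).symm
  let g (n : ℕ) : Abelian.Ext (quotPow 𝔞 n) M i →ₗ[R] (Limits.colimit F : ModuleCat.{u} R) :=
    (Limits.colimit.ι F (.op (.op n))).hom ∘ₗ (c n).inv.hom
  have hg (n : ℕ) (x) : g n ((c n).hom.hom x) = (Limits.colimit.ι F (.op (.op n))).hom x :=
    congrArg (Limits.colimit.ι F (.op (.op n))).hom (congrArg (fun f ↦ f.hom x) (c n).hom_inv_id)
  have hs (n : ℕ) : Function.Surjective (c n).hom.hom := fun x ↦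
    ⟨(c n).inv.hom x, congrArg (fun f ↦ f.hom x) (c n).inv_hom_id⟩
  refine ⟨(LinearEquiv.ofBijective _ (Module.DirectLimit.lift_bijective g ?_ ?_ ?_)).trans
    e.toLinearEquiv.symm⟩
  · intro n m h x
    obtain ⟨x, rfl⟩ := hs n x
    rw [hc, hg, hg]
    exact congrArg (fun f ↦ f.hom x) (Limits.colimit.w F (homOfLE h).op.op)
  · intro p
    obtain ⟨n, x, hx⟩ := Limits.Concrete.colimit_exists_rep F p
    exact ⟨n.unop.unop, (c _).hom.hom x, (hg _ _).trans hx⟩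
  · intro n x hx
    obtain ⟨x, rfl⟩ := hs n x
    rw [hg] at hx
    obtain ⟨m, f, hf⟩ := Limits.Concrete.colimit_rep_eq_zero R F _ x hx
    refine ⟨m.unop.unop, leOfHom f.unop.unop, ?_⟩
    rw [hc]
    exact (congrArg _ hf).trans (map_zero _)

end localCohomology

end

section

variable {R : Type u} [CommRing R]

lemma Module.Finite.of_function_exact [IsNoetherianRing R] {A B C : Type*} [AddCommGroup A]
    [Module R A] [AddCommGroup B] [Module R B] [AddCommGroup C] [Module R C] {f : A →ₗ[R] B}
    {g : B →ₗ[R] C} (h : Function.Exact f g) [Module.Finite R A] [Module.Finite R C] :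
    Module.Finite R B :=
  have := isNoetherian_of_range_eq_ker f g h.linearMap_ker_eq.symm
  inferInstance

/-- `Ext^i(R/𝔞, M)` is finitely generated. -/
def Ideal.FiniteExt (𝔞 : Ideal R) (M : Type u) [AddCommGroup M] [Module R M] (i : ℕ) : Prop :=
  Module.Finite R (Abelian.Ext (ModuleCat.of R (R ⧸ 𝔞)) (ModuleCat.of R M) i)

lemma LinearMap.shortExact_of_exact {A B C : Type u} [AddCommGroup A] [Module R A]
    [AddCommGroup B] [Module R B] [AddCommGroup C] [Module R C] {f : A →ₗ[R] B} {g : B →ₗ[R] C}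
    (hf : Function.Injective f) (hg : Function.Surjective g) (h : Function.Exact f g) :
    (ShortComplex.mk (ModuleCat.ofHom f) (ModuleCat.ofHom g)
      (by ext x; exact h.apply_apply_eq_zero x)).ShortExact where
  exact := (ShortComplex.moduleCat_exact_iff _).2 fun x hx ↦ (h x).1 hx
  mono_f := (ModuleCat.mono_iff_injective _).2 hf
  epi_g := (ModuleCat.epi_iff_surjective _).2 hg

lemma extModule_finite_iff {𝔞 : Ideal R} {M : Type u} [AddCommGroup M] [Module R M] {i : ℕ} :
    Module.Finite R (((Ext R (ModuleCat.{u} R) i).obj (Opposite.op (ModuleCat.of R (R ⧸ 𝔞)))).obj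
      (ModuleCat.of R M)) ↔ 𝔞.FiniteExt M i :=
  Module.Finite.equiv_iff (extObjObjIso R _ _ _).toLinearEquiv

namespace Ideal.FiniteExt

variable {𝔞 : Ideal R}

section

variable {M N : Type u} [AddCommGroup M] [Module R M] [AddCommGroup N] [Module R N]

lemma congr (e : M ≃ₗ[R] N) {i : ℕ} (h : 𝔞.FiniteExt M i) : 𝔞.FiniteExt N i := by
  have := h
  rw [Ideal.FiniteExt] at this
  refine Module.Finite.of_surjective
    ((Abelian.Ext.mk₀ (ModuleCat.ofHom e.toLinearMap)).postcompOfLinear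
    R (ModuleCat.of R (R ⧸ 𝔞)) (add_zero i)) fun x ↦
      ⟨x.comp (Abelian.Ext.mk₀ (ModuleCat.ofHom e.symm.toLinearMap)) (add_zero i), ?_⟩
  simp only [Abelian.Ext.bilinearCompOfLinear_apply_apply, LinearMap.flip_apply,
    Abelian.Ext.comp_assoc_of_third_deg_zero, Abelian.Ext.mk₀_comp_mk₀]
  have : ModuleCat.ofHom e.symm.toLinearMap ≫ ModuleCat.ofHom e.toLinearMap = 𝟙 _ := by
    ext; simp
  rw [this]
  simp

lemma zero_iff : 𝔞.FiniteExt M 0 ↔ Module.Finite R (Submodule.torsionBySet R M 𝔞) := by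
  let φ : (R ⧸ 𝔞 →ₗ[R] M) →ₗ[R] Submodule.torsionBySet R M 𝔞 :=
    (LinearMap.applyₗ (1 : R ⧸ 𝔞)).codRestrict _ fun f ↦
      (Submodule.mem_torsionBySet_iff _ _).2 fun a ↦ by
        rw [LinearMap.applyₗ_apply_apply, ← map_smul, Algebra.smul_def, mul_one,
          Ideal.Quotient.algebraMap_eq, Ideal.Quotient.eq_zero_iff_mem.2 a.2, map_zero]
  have hφ : Function.Bijective φ := by
    refine ⟨fun f g h ↦ ?_, fun m ↦ ⟨Submodule.liftQ _ (LinearMap.toSpanSingleton R M m)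
      fun a ha ↦ by simpa using (Submodule.mem_torsionBySet_iff _ _).1 m.2 ⟨a, ha⟩, ?_⟩⟩
    · have h1 : f 1 = g 1 := congrArg Subtype.val h
      ext
      exact h1
    · ext
      exact one_smul R m.1
  exact Module.Finite.equiv_iff
    ((Abelian.Ext.linearEquiv₀.trans ModuleCat.homLinearEquiv).trans
      (LinearEquiv.ofBijective φ hφ))

lemma of_finite [IsNoetherianRing R] [Module.Finite R M] (i : ℕ) : 𝔞.FiniteExt M i :=
  ModuleCat.finite_ext R _ _ i

end

section

variable {A B C : Type u} [AddCommGroup A] [Module R A]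
  [AddCommGroup B] [Module R B] [AddCommGroup C] [Module R C] {f : A →ₗ[R] B} {g : B →ₗ[R] C}

section

variable [IsNoetherianRing R]

lemma middle (hf : Function.Injective f) (hg : Function.Surjective g) (h : Function.Exact f g)
    {i : ℕ} (hA : 𝔞.FiniteExt A i) (hC : 𝔞.FiniteExt C i) : 𝔞.FiniteExt B i := by
  rw [Ideal.FiniteExt] at hA hC
  have hS := LinearMap.shortExact_of_exact hf hg h
  exact Module.Finite.of_function_exact
    (f := (Abelian.Ext.mk₀ (ModuleCat.ofHom f)).postcompOfLinear R _ (add_zero i))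
    (g := (Abelian.Ext.mk₀ (ModuleCat.ofHom g)).postcompOfLinear R _ (add_zero i))
    ((ShortComplex.ab_exact_iff_function_exact _).1
      (Abelian.Ext.covariant_sequence_exact₂' (ModuleCat.of R (R ⧸ 𝔞)) hS i))

lemma right (hf : Function.Injective f) (hg : Function.Surjective g) (h : Function.Exact f g)
    {i : ℕ} (hB : 𝔞.FiniteExt B i) (hA : 𝔞.FiniteExt A (i + 1)) : 𝔞.FiniteExt C i := by
  rw [Ideal.FiniteExt] at hA hB
  have hS := LinearMap.shortExact_of_exact hf hg h
  exact Module.Finite.of_function_exact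
    (f := (Abelian.Ext.mk₀ (ModuleCat.ofHom g)).postcompOfLinear R _ (add_zero i))
    (g := hS.extClass.postcompOfLinear R _ rfl)
    ((ShortComplex.ab_exact_iff_function_exact _).1
      (Abelian.Ext.covariant_sequence_exact₃' (ModuleCat.of R (R ⧸ 𝔞)) hS i (i + 1) rfl))

lemma left (hf : Function.Injective f) (hg : Function.Surjective g) (h : Function.Exact f g)
    {i : ℕ} (hC : 𝔞.FiniteExt C i) (hB : 𝔞.FiniteExt B (i + 1)) : 𝔞.FiniteExt A (i + 1) := by
  rw [Ideal.FiniteExt] at hC hB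
  have hS := LinearMap.shortExact_of_exact hf hg h
  exact Module.Finite.of_function_exact
    (f := hS.extClass.postcompOfLinear R _ rfl)
    (g := (Abelian.Ext.mk₀ (ModuleCat.ofHom f)).postcompOfLinear R _ (add_zero (i + 1)))
    ((ShortComplex.ab_exact_iff_function_exact _).1
      (Abelian.Ext.covariant_sequence_exact₁' (ModuleCat.of R (R ⧸ 𝔞)) hS i (i + 1) rfl))

lemma left_zero (hf : Function.Injective f) (hB : 𝔞.FiniteExt B 0) : 𝔞.FiniteExt A 0 := by
  rw [zero_iff] at hB ⊢
  refine Module.Finite.of_injective (f.restrict (p := Submodule.torsionBySet R A 𝔞)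
    (q := Submodule.torsionBySet R B 𝔞) fun x hx ↦ ?_) fun x y hxy ↦ ?_
  · rw [Submodule.mem_torsionBySet_iff] at hx ⊢
    intro a
    rw [← map_smul, hx a, map_zero]
  · exact Subtype.ext (hf (congrArg Subtype.val hxy))

end

end

end Ideal.FiniteExt

end

section

namespace Ideal

variable {R : Type u} [CommRing R] (𝔞 : Ideal R)

section

variable (M : Type*) [AddCommGroup M] [Module R M]

/-- The submodule `Γ_𝔞(M)` of elements killed by a power of `𝔞`. -/
def powTorsion : Submodule R M where
  carrier := {x | ∃ n, ∀ a ∈ 𝔞 ^ n, a • x = 0}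
  zero_mem' := ⟨0, fun _ _ ↦ smul_zero _⟩
  add_mem' := by
    rintro x y ⟨n, hn⟩ ⟨m, hm⟩
    refine ⟨max n m, fun a ha ↦ ?_⟩
    rw [smul_add, hn a (Ideal.pow_le_pow_right (le_max_left _ _) ha),
      hm a (Ideal.pow_le_pow_right (le_max_right _ _) ha), add_zero]
  smul_mem' := by
    rintro r x ⟨n, hn⟩
    exact ⟨n, fun a ha ↦ by rw [smul_comm, hn a ha, smul_zero]⟩

variable {M} {𝔞}

lemma mem_powTorsion {x : M} : x ∈ 𝔞.powTorsion M ↔ ∃ n, ∀ a ∈ 𝔞 ^ n, a • x = 0 := Iff.rfl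

lemma map_mem_powTorsion {N : Type*} [AddCommGroup N] [Module R N] (f : M →ₗ[R] N) {x : M}
    (hx : x ∈ 𝔞.powTorsion M) : f x ∈ 𝔞.powTorsion N := by
  obtain ⟨n, hn⟩ := hx
  exact ⟨n, fun a ha ↦ by rw [← map_smul, hn a ha, map_zero]⟩

lemma powTorsion_eq_top_of_injective {N : Type*} [AddCommGroup N] [Module R N] {f : M →ₗ[R] N}
    (hf : Function.Injective f) (h : 𝔞.powTorsion N = ⊤) : 𝔞.powTorsion M = ⊤ := by
  refine eq_top_iff.2 fun x _ ↦ ?_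
  obtain ⟨n, hn⟩ : f x ∈ 𝔞.powTorsion N := h ▸ Submodule.mem_top
  exact ⟨n, fun a ha ↦ hf (by rw [map_smul, hn a ha, map_zero])⟩

lemma powTorsion_eq_top_of_surjective {N : Type*} [AddCommGroup N] [Module R N] {f : M →ₗ[R] N}
    (hf : Function.Surjective f) (h : 𝔞.powTorsion M = ⊤) : 𝔞.powTorsion N = ⊤ := by
  refine eq_top_iff.2 fun x _ ↦ ?_
  obtain ⟨x, rfl⟩ := hf x
  exact map_mem_powTorsion f (h ▸ Submodule.mem_top)

lemma powTorsion_powTorsion : 𝔞.powTorsion (𝔞.powTorsion M) = ⊤ := by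
  refine eq_top_iff.2 fun x _ ↦ ?_
  obtain ⟨n, hn⟩ := x.2
  exact ⟨n, fun a ha ↦ Subtype.ext (hn a ha)⟩

lemma powTorsion_quotient_pow (n : ℕ) : 𝔞.powTorsion (R ⧸ 𝔞 ^ n) = ⊤ := by
  refine eq_top_iff.2 fun x _ ↦ ⟨n, fun a ha ↦ ?_⟩
  obtain ⟨x, rfl⟩ := Ideal.Quotient.mk_surjective x
  rw [← Ideal.Quotient.mk_eq_mk, ← Submodule.Quotient.mk_smul, smul_eq_mul,
    (Submodule.Quotient.mk_eq_zero _).2 (Ideal.mul_mem_right x _ ha)]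

lemma exists_pow_smul_eq_bot {N : Submodule R M} (hN : N.FG) (h : N ≤ 𝔞.powTorsion M) :
    ∃ k, 𝔞 ^ k • N = ⊥ := by
  induction N, hN using Submodule.fg_induction with
  | singleton x =>
    obtain ⟨k, hk⟩ := h (Submodule.mem_span_singleton_self x)
    refine ⟨k, (Submodule.eq_bot_iff _).2 fun y hy ↦ ?_⟩
    obtain ⟨a, ha, rfl⟩ := Submodule.mem_smul_span_singleton.1 hy
    exact hk a ha
  | sup N₁ N₂ _ _ h₁ h₂ =>
    obtain ⟨k, hk⟩ := h₁ (le_sup_left.trans h)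
    obtain ⟨l, hl⟩ := h₂ (le_sup_right.trans h)
    refine ⟨max k l, ?_⟩
    rw [Submodule.smul_sup, eq_bot_iff, sup_le_iff, ← hk, and_iff_right (Submodule.smul_mono_left
      (Ideal.pow_le_pow_right (le_max_left _ _))), hk, ← hl]
    exact Submodule.smul_mono_left (Ideal.pow_le_pow_right (le_max_right _ _))

lemma powTorsion_quotient_eq_bot [IsNoetherianRing R] : 𝔞.powTorsion (M ⧸ 𝔞.powTorsion M) = ⊥ := by
  refine (Submodule.eq_bot_iff _).2 fun x ↦ ?_
  obtain ⟨x, rfl⟩ := Submodule.Quotient.mk_surjective _ x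
  rintro ⟨n, hn⟩
  obtain ⟨k, hk⟩ := exists_pow_smul_eq_bot (N := 𝔞 ^ n • Submodule.span R {x})
    (Submodule.FG.smul (IsNoetherian.noetherian _) (Submodule.fg_span_singleton x)) (by
      intro y hy
      obtain ⟨a, ha, rfl⟩ := Submodule.mem_smul_span_singleton.1 hy
      exact (Submodule.Quotient.mk_eq_zero _).1 (hn a ha))
  rw [← mul_smul, ← pow_add] at hk
  refine (Submodule.Quotient.mk_eq_zero _).2 ⟨k + n, fun a ha ↦ (Submodule.mem_bot R).1 ?_⟩
  rw [← hk]
  exact Submodule.smul_mem_smul ha (Submodule.mem_span_singleton_self x)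

end

section

variable [IsNoetherianRing R] {E : Type u} [AddCommGroup E] [Module R E]

lemma injective_powTorsion [Module.Injective R E] : Module.Injective R (𝔞.powTorsion E) := by
  refine Module.Baer.injective fun I g ↦ ?_
  obtain ⟨k, hk⟩ := exists_pow_smul_eq_bot (𝔞 := 𝔞)
    (N := LinearMap.range ((𝔞.powTorsion E).subtype ∘ₗ g))
    (by rw [LinearMap.range_eq_map]; exact (Module.Finite.fg_top).map _) (by
      rintro _ ⟨x, rfl⟩
      exact (g x).2)
  obtain ⟨c, hc⟩ := Ideal.exists_pow_inf_eq_pow_smul (M := R) 𝔞 I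
  let ψ : I →ₗ[R] R ⧸ 𝔞 ^ (c + k) := (𝔞 ^ (c + k)).mkQ ∘ₗ I.subtype
  have hψ : LinearMap.ker ψ ≤ LinearMap.ker g := by
    intro x hx
    have hx1 : (x : R) ∈ 𝔞 ^ (c + k) := (Submodule.Quotient.mk_eq_zero _).1 hx
    have hx2 : (x : R) ∈ 𝔞 ^ k • (𝔞 ^ c • (⊤ : Submodule R R) ⊓ I) := by
      have := hc (c + k) (by lia)
      rw [Nat.add_sub_cancel_left] at this
      rw [← this]
      exact ⟨by simpa using hx1, x.2⟩
    have hx3 : x ∈ 𝔞 ^ k • (⊤ : Submodule R I) := by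
      have hx4 : (x : R) ∈ (𝔞 ^ k • (⊤ : Submodule R I)).map I.subtype := by
        rw [Submodule.map_smul'', Submodule.map_top, Submodule.range_subtype]
        exact Submodule.smul_mono le_rfl inf_le_right hx2
      obtain ⟨y, hy, hxy⟩ := hx4
      rwa [← Subtype.ext hxy]
    have hx5 : ((𝔞.powTorsion E).subtype ∘ₗ g) x ∈
        (𝔞 ^ k • (⊤ : Submodule R I)).map ((𝔞.powTorsion E).subtype ∘ₗ g) := ⟨x, hx3, rfl⟩
    rw [Submodule.map_smul'', Submodule.map_top, hk] at hx5
    exact Subtype.ext hx5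
  obtain ⟨h, hh⟩ := Module.Injective.out ((LinearMap.ker ψ).liftQ ψ le_rfl)
    (LinearMap.ker_eq_bot.1 (Submodule.ker_liftQ_eq_bot' _ _ rfl))
    ((𝔞.powTorsion E).subtype ∘ₗ (LinearMap.ker ψ).liftQ g hψ)
  exact ⟨(h.codRestrict (𝔞.powTorsion E) fun x ↦ map_mem_powTorsion h
    (powTorsion_quotient_pow (𝔞 := 𝔞) (c + k) ▸ Submodule.mem_top)) ∘ₗ (𝔞 ^ (c + k)).mkQ,
    fun x hx ↦ Subtype.ext (hh (Submodule.Quotient.mk ⟨x, hx⟩))⟩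

lemma injective_quotient_powTorsion [Module.Injective R E] :
    Module.Injective R (E ⧸ 𝔞.powTorsion E) := by
  have := injective_powTorsion 𝔞 (E := E)
  obtain ⟨r, hr⟩ := Module.Injective.out (𝔞.powTorsion E).subtype
    (Submodule.injective_subtype _) (LinearMap.id (R := R) (M := 𝔞.powTorsion E))
  let s : E ⧸ 𝔞.powTorsion E →ₗ[R] E := (𝔞.powTorsion E).liftQ
    (LinearMap.id - (𝔞.powTorsion E).subtype ∘ₗ r) fun x hx ↦ by
      have := hr ⟨x, hx⟩
      simp only [Submodule.subtype_apply, LinearMap.id_apply] at this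
      simp [this]
  have hs (x : E ⧸ 𝔞.powTorsion E) : (𝔞.powTorsion E).mkQ (s x) = x := by
    obtain ⟨x, rfl⟩ := Submodule.Quotient.mk_surjective _ x
    simp [s]
  refine ⟨fun X Y _ _ _ _ f hf g ↦ ?_⟩
  obtain ⟨h, hh⟩ := Module.Injective.out f hf (s ∘ₗ g)
  exact ⟨(𝔞.powTorsion E).mkQ ∘ₗ h, fun x ↦ by simp [hh, hs, -Submodule.mkQ_apply]⟩

end

section

variable (M : Type u) [AddCommGroup M] [Module R M]

lemma _root_.Module.exists_injective_of_injective :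
    ∃ (E : Type u) (_ : AddCommGroup E) (_ : Module R E)
    (f : M →ₗ[R] E), Function.Injective f ∧ Module.Injective R E := by
  let ι := CategoryTheory.Injective.ι (ModuleCat.of R M)
  exact ⟨_, _, _, ι.hom, (ModuleCat.mono_iff_injective _).1 inferInstance,
    Module.injective_module_of_injective_object (R := R) (inj := inferInstanceAs
      (CategoryTheory.Injective (CategoryTheory.Injective.under (ModuleCat.of R M))))⟩

variable {M} {𝔞} [IsNoetherianRing R]

lemma exists_injective_of_powTorsion_eq_bot (hM : 𝔞.powTorsion M = ⊥) :
    ∃ (E : Type u) (_ : AddCommGroup E) (_ : Module R E) (f : M →ₗ[R] E),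
      Function.Injective f ∧ Module.Injective R E ∧ 𝔞.powTorsion E = ⊥ := by
  obtain ⟨E, _, _, f, hf, _⟩ := Module.exists_injective_of_injective (R := R) M
  refine ⟨_, _, _, (𝔞.powTorsion E).mkQ ∘ₗ f, ?_, injective_quotient_powTorsion 𝔞,
    powTorsion_quotient_eq_bot⟩
  refine (injective_iff_map_eq_zero _).2 fun x hx ↦ ?_
  obtain ⟨n, hn⟩ := (Submodule.Quotient.mk_eq_zero _).1 hx
  rw [← Submodule.mem_bot R, ← hM]
  exact ⟨n, fun a ha ↦ hf (by rw [map_smul, hn a ha, map_zero])⟩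

lemma exists_injective_of_powTorsion_eq_top (hM : 𝔞.powTorsion M = ⊤) :
    ∃ (E : Type u) (_ : AddCommGroup E) (_ : Module R E) (f : M →ₗ[R] E),
      Function.Injective f ∧ Module.Injective R E ∧ 𝔞.powTorsion E = ⊤ := by
  obtain ⟨E, _, _, f, hf, _⟩ := Module.exists_injective_of_injective (R := R) M
  exact ⟨_, _, _, f.codRestrict (𝔞.powTorsion E) fun x ↦ map_mem_powTorsion f
    (hM ▸ Submodule.mem_top), fun x y h ↦ hf (congrArg Subtype.val h), injective_powTorsion 𝔞,
    powTorsion_powTorsion⟩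

end

end Ideal

end

section

namespace localCohomology

variable {R : Type u} [CommRing R] (𝔞 : Ideal R)

lemma extPowMap_self (M : ModuleCat.{u} R) {i n : ℕ} (x : Abelian.Ext (quotPow 𝔞 n) M i) :
    extPowMap 𝔞 M i n n le_rfl x = x := by
  have : quotPowMap 𝔞 (le_refl n) = 𝟙 _ :=
    (ringModIdeals (idealPowersDiagram 𝔞)).map_id _
  rw [extPowMap_apply, this, Abelian.Ext.mk₀_id_comp]

instance (M : ModuleCat.{u} R) (i : ℕ) : DirectedSystem
    (fun n ↦ Abelian.Ext (quotPow 𝔞 n) M i) fun n m h ↦ extPowMap 𝔞 M i n m h where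
  map_self _ x := extPowMap_self 𝔞 M x
  map_map _ _ _ h h' x := extPowMap_extPowMap 𝔞 M h h' x

variable {𝔞} in
lemma nonempty_extLimit_equiv_of_comp {M N : ModuleCat.{u} R} {i j k : ℕ} (e : Abelian.Ext M N j)
    (hk : i + j = k)
    (hsurj : ∀ n (y : Abelian.Ext (quotPow 𝔞 n) N k), ∃ m, ∃ h : n ≤ m, ∃ x,
      Abelian.Ext.comp x e hk = extPowMap 𝔞 N k n m h y)
    (hinj : ∀ n (x : Abelian.Ext (quotPow 𝔞 n) M i), x.comp e hk = 0 → ∃ m, ∃ h : n ≤ m,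
      extPowMap 𝔞 M i n m h x = 0) :
    Nonempty (ExtLimit 𝔞 M i ≃ₗ[R] ExtLimit 𝔞 N k) := by
  refine ⟨LinearEquiv.ofBijective _ (Module.DirectLimit.lift_bijective
    (fun n ↦ Module.DirectLimit.of R ℕ (fun n ↦ Abelian.Ext (quotPow 𝔞 n) N k)
      (extPowMap 𝔞 N k) n ∘ₗ e.postcompOfLinear R _ hk) ?_ ?_ ?_)⟩
  · intro n m h x
    change Module.DirectLimit.of R ℕ (fun n ↦ Abelian.Ext (quotPow 𝔞 n) N k)
      (extPowMap 𝔞 N k) m ((extPowMap 𝔞 M i n m h x).comp e hk) =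
      Module.DirectLimit.of R ℕ (fun n ↦ Abelian.Ext (quotPow 𝔞 n) N k)
      (extPowMap 𝔞 N k) n (x.comp e hk)
    rw [extPowMap_comp, Module.DirectLimit.of_f]
  · intro p
    obtain ⟨n, y, rfl⟩ := Module.DirectLimit.exists_of p
    obtain ⟨m, h, x, hx⟩ := hsurj n y
    refine ⟨m, x, ?_⟩
    change Module.DirectLimit.of R ℕ (fun n ↦ Abelian.Ext (quotPow 𝔞 n) N k)
      (extPowMap 𝔞 N k) m (x.comp e hk) = _
    rw [hx, Module.DirectLimit.of_f]
  · intro n x hx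
    obtain ⟨m, h, hm⟩ := Module.DirectLimit.of.zero_exact hx
    change extPowMap 𝔞 N k n m h (x.comp e hk) = 0 at hm
    rw [← extPowMap_comp] at hm
    obtain ⟨l, hl, hx⟩ := hinj m _ hm
    exact ⟨l, h.trans hl, by rw [← extPowMap_extPowMap _ _ h hl, hx]⟩

variable {𝔞}

lemma ext_eq_zero {E : Type u} [AddCommGroup E] [Module R E] [Module.Injective R E]
    (X : ModuleCat.{u} R) {j : ℕ}
    (x : Abelian.Ext X (ModuleCat.of R E) (j + 1)) : x = 0 :=
  have := Module.injective_object_of_injective_module R E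
  Abelian.Ext.eq_zero_of_injective x

lemma hom_eq_zero_of_powTorsion_eq_bot {M : Type u} [AddCommGroup M] [Module R M]
    (h : 𝔞.powTorsion M = ⊥) {n : ℕ} (x : Abelian.Ext (quotPow 𝔞 n) (ModuleCat.of R M) 0) :
    x = 0 := by
  obtain ⟨f, rfl⟩ := Abelian.Ext.addEquiv₀.symm.surjective x
  have : f = 0 := by
    ext
    refine (Submodule.mem_bot R).1 (h ▸ Ideal.map_mem_powTorsion f.hom ?_)
    rw [Ideal.powTorsion_quotient_pow]
    trivial
  rw [this, map_zero]

lemma nonempty_extLimit_zero_equiv (M : Type u) [AddCommGroup M] [Module R M] :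
    Nonempty (ExtLimit 𝔞 (ModuleCat.of R M) 0 ≃ₗ[R] 𝔞.powTorsion M) := by
  let g (n : ℕ) : Abelian.Ext (quotPow 𝔞 n) (ModuleCat.of R M) 0 →ₗ[R] 𝔞.powTorsion M :=
    ((LinearMap.applyₗ (1 : R ⧸ 𝔞 ^ n)).codRestrict _ fun f ↦ Ideal.map_mem_powTorsion f
      (Ideal.powTorsion_quotient_pow (𝔞 := 𝔞) n ▸ Submodule.mem_top)) ∘ₗ
      (Abelian.Ext.linearEquiv₀.trans ModuleCat.homLinearEquiv).toLinearMap
  have hg (n : ℕ) (f : quotPow 𝔞 n ⟶ ModuleCat.of R M) :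
      (g n (Abelian.Ext.mk₀ f) : M) = f.hom (1 : R ⧸ 𝔞 ^ n) := by
    have : Abelian.Ext.linearEquiv₀ (R := R) (Abelian.Ext.mk₀ f) = f :=
      Abelian.Ext.linearEquiv₀.apply_symm_apply f
    exact congrArg (fun f ↦ f.hom (1 : R ⧸ 𝔞 ^ n)) this
  refine ⟨LinearEquiv.ofBijective _ (Module.DirectLimit.lift_bijective g ?_ ?_ ?_)⟩
  · intro n m h x
    obtain ⟨f, rfl⟩ := (Abelian.Ext.mk₀_bijective _ _).2 x
    rw [extPowMap_apply, Abelian.Ext.mk₀_comp_mk₀]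
    exact Subtype.ext ((hg m _).trans (hg n f).symm)
  · rintro ⟨x, n, hn⟩
    refine ⟨n, Abelian.Ext.mk₀ (ModuleCat.ofHom <|
      Submodule.liftQ _ (LinearMap.toSpanSingleton R M x) hn), Subtype.ext ((hg _ _).trans ?_)⟩
    exact one_smul R x
  · intro n x hx
    obtain ⟨f, rfl⟩ := (Abelian.Ext.mk₀_bijective _ _).2 x
    have : f = 0 := by
      ext
      exact (hg _ _).symm.trans (congrArg Subtype.val hx)
    exact ⟨n, le_rfl, by rw [this, Abelian.Ext.mk₀_zero, map_zero]⟩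

variable [IsNoetherianRing R]

lemma exists_extPowMap_eq_zero {M : Type u} [AddCommGroup M] [Module R M]
    (h : 𝔞.powTorsion M = ⊤) {i n : ℕ}
    (x : Abelian.Ext (quotPow 𝔞 n) (ModuleCat.of R M) (i + 1)) :
    ∃ m, ∃ h : n ≤ m, extPowMap 𝔞 _ _ n m h x = 0 := by
  induction i generalizing M n with
  | zero =>
    obtain ⟨E, _, _, f, hf, _, hE⟩ := Ideal.exists_injective_of_powTorsion_eq_top h
    have hS := LinearMap.shortExact_of_exact hf (Submodule.mkQ_surjective (LinearMap.range f))
      (LinearMap.exact_map_mkQ_range f)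
    obtain ⟨y, rfl⟩ := Abelian.Ext.covariant_sequence_exact₁ _ hS x (ext_eq_zero _ _) rfl
    obtain ⟨g, rfl⟩ := Abelian.Ext.addEquiv₀.symm.surjective y
    obtain ⟨e, he⟩ := Submodule.mkQ_surjective _ (g.hom (1 : R ⧸ 𝔞 ^ n))
    obtain ⟨m, hm⟩ : e ∈ 𝔞.powTorsion E := hE ▸ Submodule.mem_top
    let g' : quotPow 𝔞 (max n m) ⟶ ModuleCat.of R E := ModuleCat.ofHom <|
      Submodule.liftQ _ (LinearMap.toSpanSingleton R E e) fun a ha ↦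
        hm a (Ideal.pow_le_pow_right (le_max_right _ _) ha)
    have hg' : g' ≫ ModuleCat.ofHom (LinearMap.range f).mkQ =
        quotPowMap 𝔞 (le_max_left n m) ≫ g := by
      ext
      exact (congrArg _ (one_smul R e)).trans he
    refine ⟨max n m, le_max_left _ _, ?_⟩
    rw [← extPowMap_comp, extPowMap_apply, Abelian.Ext.addEquiv₀_symm_apply,
      Abelian.Ext.mk₀_comp_mk₀, ← hg', ← Abelian.Ext.mk₀_comp_mk₀,
      Abelian.Ext.comp_assoc _ _ _ (add_zero 0) (zero_add 1) (by lia)]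
    erw [hS.comp_extClass]
    simp
  | succ i ih =>
    obtain ⟨E, _, _, f, hf, _, hE⟩ := Ideal.exists_injective_of_powTorsion_eq_top h
    have hS := LinearMap.shortExact_of_exact hf (Submodule.mkQ_surjective (LinearMap.range f))
      (LinearMap.exact_map_mkQ_range f)
    obtain ⟨y, rfl⟩ := Abelian.Ext.covariant_sequence_exact₁ _ hS x (ext_eq_zero _ _) rfl
    obtain ⟨m, hnm, hy⟩ := ih (Ideal.powTorsion_eq_top_of_surjective
      (Submodule.mkQ_surjective _) hE) y
    exact ⟨m, hnm, by rw [← extPowMap_comp, hy, Abelian.Ext.zero_comp]⟩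

variable (M : Type u) [AddCommGroup M] [Module R M]

lemma nonempty_extLimit_succ_equiv_quotient (i : ℕ) :
    Nonempty (ExtLimit 𝔞 (ModuleCat.of R M) (i + 1) ≃ₗ[R]
      ExtLimit 𝔞 (ModuleCat.of R (M ⧸ 𝔞.powTorsion M)) (i + 1)) := by
  have hS := LinearMap.shortExact_of_exact (Submodule.injective_subtype (𝔞.powTorsion M))
    (Submodule.mkQ_surjective _) (LinearMap.exact_subtype_mkQ _)
  refine nonempty_extLimit_equiv_of_comp
    (Abelian.Ext.mk₀ (ModuleCat.ofHom (𝔞.powTorsion M).mkQ)) (add_zero _) (fun n y ↦ ?_)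
    fun n x hx ↦ ?_
  · obtain ⟨m, h, hy⟩ := exists_extPowMap_eq_zero Ideal.powTorsion_powTorsion
      (y.comp hS.extClass rfl)
    rw [← extPowMap_comp] at hy
    obtain ⟨x, hx⟩ := Abelian.Ext.covariant_sequence_exact₃ _ hS _ rfl hy
    exact ⟨m, h, x, hx⟩
  · obtain ⟨z, rfl⟩ := Abelian.Ext.covariant_sequence_exact₂ _ hS _ hx
    obtain ⟨m, h, hz⟩ := exists_extPowMap_eq_zero Ideal.powTorsion_powTorsion z
    exact ⟨m, h, by rw [← extPowMap_comp, hz, Abelian.Ext.zero_comp]⟩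

/-- Dimension shifting for local cohomology along the cosyzygy of `M / Γ_𝔞(M)` in an injective
module without `𝔞`-power torsion. -/
theorem exists_shift (𝔞 : Ideal R) : ∃ (D : Type u) (_ : AddCommGroup D) (_ : Module R D),
    (∀ i, Nonempty (ExtLimit 𝔞 (ModuleCat.of R M) (i + 1) ≃ₗ[R]
      ExtLimit 𝔞 (ModuleCat.of R D) i)) ∧
    (∀ i, 𝔞.FiniteExt D i ↔ 𝔞.FiniteExt (M ⧸ 𝔞.powTorsion M) (i + 1)) := by
  have hM' : 𝔞.powTorsion (M ⧸ 𝔞.powTorsion M) = ⊥ := Ideal.powTorsion_quotient_eq_bot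
  obtain ⟨E, _, _, f, hf, _, hE⟩ := Ideal.exists_injective_of_powTorsion_eq_bot hM'
  have hS := LinearMap.shortExact_of_exact hf (Submodule.mkQ_surjective (LinearMap.range f))
    (LinearMap.exact_map_mkQ_range f)
  have hE0 {n i : ℕ} (x : Abelian.Ext (quotPow 𝔞 n) (ModuleCat.of R E) i) : x = 0 := by
    cases i
    · exact hom_eq_zero_of_powTorsion_eq_bot hE x
    · exact ext_eq_zero _ x
  have hEF (i : ℕ) : 𝔞.FiniteExt E i := by
    rcases i with _ | i
    · rw [Ideal.FiniteExt.zero_iff]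
      have : Submodule.torsionBySet R E 𝔞 = ⊥ := by
        refine eq_bot_iff.2 (le_trans (fun x hx ↦ ?_) hE.le)
        refine Ideal.mem_powTorsion.2 ⟨1, fun a ha ↦ ?_⟩
        rw [pow_one] at ha
        exact (Submodule.mem_torsionBySet_iff _ _).1 hx ⟨a, ha⟩
      rw [this]
      infer_instance
    · have : Subsingleton (Abelian.Ext (ModuleCat.of R (R ⧸ 𝔞)) (ModuleCat.of R E) (i + 1)) :=
        subsingleton_of_forall_eq 0 (ext_eq_zero _)
      rw [Ideal.FiniteExt]
      infer_instance
  refine ⟨E ⧸ LinearMap.range f, inferInstance, inferInstance, fun i ↦ ?_, fun i ↦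
    ⟨fun h ↦ ?_, fun h ↦ ?_⟩⟩
  · obtain ⟨e⟩ := nonempty_extLimit_succ_equiv_quotient (𝔞 := 𝔞) M i
    obtain ⟨e'⟩ : Nonempty (ExtLimit 𝔞 (ModuleCat.of R (E ⧸ LinearMap.range f)) i ≃ₗ[R]
        ExtLimit 𝔞 (ModuleCat.of R (M ⧸ 𝔞.powTorsion M)) (i + 1)) := by
      refine nonempty_extLimit_equiv_of_comp hS.extClass rfl (fun n y ↦ ?_) fun n x hx ↦ ?_
      · obtain ⟨x, hx⟩ := Abelian.Ext.covariant_sequence_exact₁ _ hS y (hE0 _) rfl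
        exact ⟨n, le_rfl, x, hx.trans (extPowMap_self 𝔞 _ y).symm⟩
      · obtain ⟨z, rfl⟩ := Abelian.Ext.covariant_sequence_exact₃ _ hS _ rfl hx
        refine ⟨n, le_rfl, ?_⟩
        rw [hE0 z, Abelian.Ext.zero_comp, map_zero]
    exact ⟨e.trans e'.symm⟩
  · exact .left hf (Submodule.mkQ_surjective _) (LinearMap.exact_map_mkQ_range f) h (hEF _)
  · exact .right hf (Submodule.mkQ_surjective _) (LinearMap.exact_map_mkQ_range f) (hEF _) h

end localCohomology

end

section Artinian

variable {R : Type*} [CommRing R] {M : Type*} [AddCommGroup M] [Module R M]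

open Submodule

lemma isArtinian_of_torsionBy {x : R} (hx : ∀ m : M, ∃ n, x ^ n • m = 0)
    [IsArtinian R (torsionBy R M x)] : IsArtinian R M := by
  refine monotone_stabilizes_iff_artinian.1 fun N ↦ ?_
  have hN {k l : ℕ} (h : k ≤ l) : OrderDual.ofDual (N l) ≤ OrderDual.ofDual (N k) :=
    N.monotone h
  let A (k j : ℕ) : Submodule R (torsionBy R M x) :=
    ((OrderDual.ofDual (N k)).map (LinearMap.lsmul R M (x ^ j))).comap (torsionBy R M x).subtype
  have hA {k l i j : ℕ} (h : k ≤ l) (hij : i ≤ j) : A l j ≤ A k i := by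
    rintro z ⟨y, hy, hyz⟩
    refine ⟨x ^ (j - i) • y, Submodule.smul_mem _ _ (hN h hy), ?_⟩
    rw [← hyz, LinearMap.lsmul_apply, LinearMap.lsmul_apply, ← mul_smul, ← pow_add,
      Nat.add_sub_cancel' hij]
  have hstab (j : ℕ) : ∃ n, ∀ m, n ≤ m → A n j = A m j :=
    IsArtinian.monotone_stabilizes ⟨fun k ↦ OrderDual.toDual (A k j), fun k l h ↦ hA h le_rfl⟩
  obtain ⟨d, hd⟩ : ∃ n, ∀ m, n ≤ m → A n n = A m m :=
    IsArtinian.monotone_stabilizes ⟨fun k ↦ OrderDual.toDual (A k k), fun k l h ↦ hA h h⟩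
  choose n hn using hstab
  let k := (Finset.range d).sup n ⊔ d
  have hk (l j : ℕ) (hl : k ≤ l) : A k j ≤ A l j := by
    rcases lt_or_ge j d with hj | hj
    · have : n j ≤ k := (Finset.le_sup (Finset.mem_range.2 hj)).trans le_sup_left
      rw [← hn j _ this, hn j _ (this.trans hl)]
    · calc A k j ≤ A d d := hA le_sup_right hj
        _ = A (max l j) (max l j) := hd _ (hj.trans (le_max_right _ _))
        _ ≤ A l j := hA (le_max_left _ _) (le_max_right _ _)
  refine ⟨k, fun l hl ↦ le_antisymm (N.monotone hl) fun y hy ↦ ?_⟩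
  change y ∈ OrderDual.ofDual (N l)
  obtain ⟨j, hj⟩ := hx y
  induction j generalizing y with
  | zero => rw [← one_smul R y, ← pow_zero x, hj]; exact zero_mem _
  | succ j ih =>
    have hz : x ^ j • y ∈ torsionBy R M x := by
      rw [mem_torsionBy_iff, ← mul_smul, ← pow_succ', hj]
    obtain ⟨z, hz, hzy⟩ : ⟨x ^ j • y, hz⟩ ∈ A l j := hk l j hl ⟨y, hy, rfl⟩
    have := ih (y - z) (sub_mem hy (hN hl hz))
      (by rw [smul_sub, sub_eq_zero]; exact hzy.symm)
    rw [← sub_add_cancel y z]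
    exact add_mem this hz

/-- Melkersson's criterion for Artinian modules. -/
theorem isArtinian_of_torsionBySet {s : Set R} (hs : s.Finite)
    (h : ∀ x ∈ s, ∀ m : M, ∃ n, x ^ n • m = 0) [IsArtinian R (torsionBySet R M s)] :
    IsArtinian R M := by
  induction s, hs using Set.Finite.induction_on generalizing M with
  | empty =>
    have : torsionBySet R M ∅ = ⊤ := by simp [torsionBySet]
    exact isArtinian_of_linearEquiv (LinearEquiv.ofTop _ this)
  | @insert x s _ _ ih =>
    have : IsArtinian R (torsionBy R M x) := by
      let φ : torsionBySet R (torsionBy R M x) s →ₗ[R] torsionBySet R M (insert x s) :=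
        ((torsionBy R M x).subtype ∘ₗ Submodule.subtype _).codRestrict _ fun z ↦ by
          rw [mem_torsionBySet_iff]
          rintro ⟨a, rfl | ha⟩
          · exact (mem_torsionBy_iff _ _).1 z.1.2
          · exact congrArg Subtype.val ((mem_torsionBySet_iff _ _).1 z.2 ⟨a, ha⟩)
      have : IsArtinian R (torsionBySet R (torsionBy R M x) s) := isArtinian_of_injective φ
        fun z w h ↦ Subtype.ext (Subtype.ext
          (congrArg (fun v : torsionBySet R M (insert x s) ↦ (v : M)) h))
      refine ih fun a ha m ↦ ?_
      obtain ⟨n, hn⟩ := h a (Set.mem_insert_of_mem _ ha) m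
      exact ⟨n, Subtype.ext hn⟩
    exact isArtinian_of_torsionBy (h x (Set.mem_insert _ _))

lemma isArtinian_of_forall_isMaximal [IsNoetherianRing R] [Module.Finite R M] {I : Ideal R}
    (hI : ∀ p : Ideal R, p.IsPrime → I ≤ p → p.IsMaximal) (hM : ∀ a ∈ I, ∀ m : M, a • m = 0) :
    IsArtinian R M := by
  have : IsArtinianRing (R ⧸ I) := by
    rw [isArtinianRing_iff_krullDimLE_zero, Ring.krullDimLE_zero_iff]
    intro Q hQ
    rw [← Ideal.map_comap_of_surjective _ Ideal.Quotient.mk_surjective Q]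
    have := hI (Q.comap (Ideal.Quotient.mk I)) (hQ.comap _)
      (Ideal.mk_ker.symm.le.trans (Ideal.ker_le_comap _))
    exact Ideal.IsMaximal.map_of_surjective_of_ker_le Ideal.Quotient.mk_surjective
      (Ideal.ker_le_comap _)
  let := Module.IsTorsionBySet.module (M := M) (I := I) fun m a ↦ hM a a.2 m
  have : IsScalarTower R (R ⧸ I) M := Module.IsTorsionBySet.isScalarTower _
  have : Module.Finite (R ⧸ I) M := Module.Finite.of_restrictScalars_finite R _ _
  have : IsArtinian (R ⧸ I) M := inferInstance
  exact isArtinian_of_surjective_algebraMap (R := R ⧸ I) Ideal.Quotient.mk_surjective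

end Artinian

section

variable {R : Type*} [CommRing R] {𝔞 : Ideal R}

lemma Ideal.mem_minimalPrimes_or_isMaximal (hdim : ringKrullDim (R ⧸ 𝔞) ≤ 1) {p : Ideal R}
    [hp : p.IsPrime] (h : 𝔞 ≤ p) : p ∈ 𝔞.minimalPrimes ∨ p.IsMaximal := by
  have := Ring.krullDimLE_one_iff.1 (Ring.krullDimLE_iff.2 (by exact_mod_cast hdim))
    (p.map (Ideal.Quotient.mk 𝔞))
    (Ideal.map_isPrime_of_surjective Ideal.Quotient.mk_surjective (by rwa [Ideal.mk_ker]))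
  have hc : (p.map (Ideal.Quotient.mk 𝔞)).comap (Ideal.Quotient.mk 𝔞) = p := by
    rw [Ideal.comap_map_of_surjective' _ Ideal.Quotient.mk_surjective, Ideal.mk_ker,
      sup_eq_left.2 h]
  refine this.imp (fun h ↦ ?_) fun h ↦ ?_
  · refine ⟨⟨hp, ‹_›⟩, fun q ⟨hq, hqa⟩ hqp ↦ ?_⟩
    have hq' : (q.map (Ideal.Quotient.mk 𝔞)).IsPrime :=
      Ideal.map_isPrime_of_surjective Ideal.Quotient.mk_surjective (by rwa [Ideal.mk_ker])
    have := Ideal.comap_mono (f := Ideal.Quotient.mk 𝔞)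
      (h.2 ⟨hq', bot_le⟩ (Ideal.map_mono hqp))
    rwa [hc, Ideal.comap_map_of_surjective' _ Ideal.Quotient.mk_surjective, Ideal.mk_ker,
      sup_eq_left.2 hqa] at this
  · rw [← hc]
    have := h
    exact Ideal.comap_isMaximal_of_surjective _ Ideal.Quotient.mk_surjective

variable [IsNoetherianRing R] {M : Type*} [AddCommGroup M] [Module R M]

open Submodule

lemma isArtinian_localizedModule {p : Ideal R} [p.IsPrime] (hp : p ∈ 𝔞.minimalPrimes)
    (hM : 𝔞.powTorsion M = ⊤) [Module.Finite R (torsionBySet R M 𝔞)] :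
    IsArtinian (Localization.AtPrime p) (LocalizedModule p.primeCompl M) := by
  let S := Localization.AtPrime p
  let f := LocalizedModule.mkLinearMap p.primeCompl M
  obtain ⟨t, ht⟩ := IsNoetherian.noetherian 𝔞
  have hta {a : R} (ha : a ∈ t) : a ∈ 𝔞 := ht ▸ Ideal.subset_span ha
  have hinv (u : p.primeCompl) : ∃ v : S, ∀ z : LocalizedModule p.primeCompl M,
      v • (u : R) • z = z := by
    refine ⟨((IsLocalization.map_units S u).unit⁻¹ : Sˣ), fun z ↦ ?_⟩
    rw [← algebraMap_smul S (u : R) z, ← mul_smul, IsUnit.val_inv_mul, one_smul]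
  have hsurj (z : LocalizedModule p.primeCompl M) : ∃ (m : M) (u : p.primeCompl) (v : S),
      (u : R) • z = f m ∧ z = v • f m := by
    obtain ⟨⟨m, u⟩, h⟩ := IsLocalizedModule.surj p.primeCompl f z
    obtain ⟨v, hv⟩ := hinv u
    exact ⟨m, u, v, h, by rw [← h]; exact (hv z).symm⟩
  let s : Set S := algebraMap R S '' t
  have hfg : Module.Finite S (torsionBySet S (LocalizedModule p.primeCompl M) s) := by
    let L := (torsionBySet R M 𝔞).map f
    have : (span S (L : Set (LocalizedModule p.primeCompl M))).FG := by
      obtain ⟨T, hT⟩ := (Module.Finite.iff_fg.1 ‹_› : (torsionBySet R M 𝔞).FG).map f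
      rw [show L = span R T from hT.symm, span_span_of_tower]
      exact ⟨T, rfl⟩
    have := Module.Finite.iff_fg.2 this
    have : torsionBySet S (LocalizedModule p.primeCompl M) s ≤ span S (L : Set _) := by
      intro z hz
      obtain ⟨m, u, v, h, rfl⟩ := hsurj z
      have hc (a : R) : ∃ c : p.primeCompl, a ∈ t → (c : R) • a • m = 0 := by
        by_cases ha : a ∈ t
        · have : f (a • m) = 0 := by
            have h0 : algebraMap R S a • v • f m = 0 :=
              (mem_torsionBySet_iff _ _).1 hz ⟨_, a, ha, rfl⟩
            rw [map_smul, ← h, smul_comm, ← algebraMap_smul S a, h0, smul_zero]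
          obtain ⟨c, hc⟩ := (IsLocalizedModule.eq_zero_iff p.primeCompl f).1 this
          exact ⟨c, fun _ ↦ hc⟩
        · exact ⟨1, fun h ↦ (ha h).elim⟩
      choose c hc using hc
      let d : p.primeCompl := ∏ a ∈ t, c a
      have hd : (d : R) • m ∈ torsionBySet R M 𝔞 := by
        have ht' : Ideal.span (t : Set R) = 𝔞 := ht
        rw [← ht', ← torsionBySet_eq_torsionBySet_span, mem_torsionBySet_iff]
        rintro ⟨a, ha⟩
        obtain ⟨e, he⟩ : c a ∣ d := Finset.dvd_prod_of_mem c ha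
        rw [he, Submonoid.coe_mul, mul_comm, mul_smul, smul_comm, smul_comm a, hc a ha, smul_zero]
      obtain ⟨w, hw⟩ := hinv d
      rw [← hw (f m), ← map_smul]
      exact smul_mem _ _ (smul_mem _ _ (subset_span ⟨_, hd, rfl⟩))
    exact Module.Finite.of_injective (Submodule.inclusion this) (Submodule.inclusion_injective _)
  have : IsArtinian S (torsionBySet S (LocalizedModule p.primeCompl M) s) := by
    refine isArtinian_of_forall_isMaximal (I := 𝔞.map (algebraMap R S)) ?_ ?_
    · intro Q hQ hQa
      have hle : Q.comap (algebraMap R S) ≤ p := fun x hx ↦ by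
        by_contra hxp
        exact hQ.ne_top (Ideal.eq_top_of_isUnit_mem _ hx
          (IsLocalization.map_units S (⟨x, hxp⟩ : p.primeCompl)))
      have h1 : Q.comap (algebraMap R S) = p := by
        refine le_antisymm hle (hp.2 ⟨hQ.comap _, Ideal.map_le_iff_le_comap.1 hQa⟩ hle)
      have h2 : IsLocalRing.maximalIdeal S ≤ Q := by
        rw [← Localization.AtPrime.map_eq_maximalIdeal, Ideal.map_le_iff_le_comap, h1]
      rw [(IsLocalRing.maximalIdeal.isMaximal S).eq_of_le hQ.ne_top h2 |>.symm]
      infer_instance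
    · intro a ha m
      rw [← ht, Ideal.map_span] at ha
      have := (torsionBySet_eq_torsionBySet_span (R := S)
        (M := LocalizedModule p.primeCompl M) s).le m.2
      exact Subtype.ext ((mem_torsionBySet_iff _ _).1 this ⟨a, ha⟩)
  refine isArtinian_of_torsionBySet (s := s) (t.finite_toSet.image _) ?_
  rintro _ ⟨a, ha, rfl⟩ z
  obtain ⟨m, u, v, h, rfl⟩ := hsurj z
  obtain ⟨n, hn⟩ : m ∈ 𝔞.powTorsion M := hM ▸ mem_top
  refine ⟨n, ?_⟩
  rw [smul_comm, ← map_pow, algebraMap_smul, ← map_smul, hn _ (Ideal.pow_mem_pow (hta ha) n),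
    map_zero, smul_zero]

lemma exists_forall_smul_pow_eq {p : Ideal R} [p.IsPrime] (hp : p ∈ 𝔞.minimalPrimes)
    (hM : 𝔞.powTorsion M = ⊤) [Module.Finite R (torsionBySet R M 𝔞)] (y : R) :
    ∃ N, ∀ n, N ≤ n → ∀ m : M, ∃ s ∉ p, ∃ m' : M, s • y ^ n • m = y ^ (n + 1) • m' := by
  have := isArtinian_localizedModule hp hM
  let S := Localization.AtPrime p
  let f := LocalizedModule.mkLinearMap p.primeCompl M
  obtain ⟨N, hN⟩ := IsArtinian.range_smul_pow_stabilizes (R := S)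
    (M := LocalizedModule p.primeCompl M) (algebraMap R S y)
  refine ⟨N, fun n hn m ↦ ?_⟩
  have h1 : (algebraMap R S y) ^ n • f m ∈ LinearMap.range ((algebraMap R S y) ^ (n + 1) •
      (LinearMap.id : LocalizedModule p.primeCompl M →ₗ[S] _)) := by
    rw [← hN _ (by lia), hN n hn]
    exact ⟨f m, rfl⟩
  obtain ⟨z, hz⟩ := h1
  obtain ⟨⟨m', u⟩, h⟩ := IsLocalizedModule.surj p.primeCompl f z
  have h2 : f ((u : R) • y ^ n • m) = f (y ^ (n + 1) • m') := by
    have hz : (algebraMap R S y) ^ (n + 1) • z = (algebraMap R S y) ^ n • f m := hz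
    rw [← map_pow, ← map_pow, algebraMap_smul, algebraMap_smul] at hz
    rw [map_smul, map_smul, map_smul, ← hz, smul_comm]
    exact congrArg _ h
  obtain ⟨c, hc⟩ := (IsLocalizedModule.eq_iff_exists p.primeCompl f).1 h2
  refine ⟨c * u, (c * u).2, (c : R) • m', ?_⟩
  rw [mul_smul, smul_comm (y ^ (n + 1))]
  exact hc

end

section

variable {R : Type u} [CommRing R] {𝔞 : Ideal R}

open Submodule

section

variable (M : Type u) [AddCommGroup M] [Module R M] (y : R)

lemma LinearMap.exact_torsionBy_subtype_rangeRestrict_lsmul :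
    Function.Exact (torsionBy R M y).subtype (LinearMap.lsmul R M y).rangeRestrict := by
  rw [LinearMap.exact_iff, LinearMap.ker_rangeRestrict, Submodule.range_subtype]
  rfl

variable {M y}

lemma Ideal.FiniteExt.of_range_lsmul [IsNoetherianRing R] {i : ℕ}
    (hK : 𝔞.FiniteExt (torsionBy R M y) i)
    (hy : 𝔞.FiniteExt (LinearMap.range (LinearMap.lsmul R M y)) i) : 𝔞.FiniteExt M i :=
  hK.middle (Submodule.injective_subtype _) (LinearMap.surjective_rangeRestrict _)
    (LinearMap.exact_torsionBy_subtype_rangeRestrict_lsmul M y) hy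

lemma Ideal.FiniteExt.of_quotient_range_lsmul [IsNoetherianRing R] (hy : y ∈ 𝔞)
    (hK : ∀ i, 𝔞.FiniteExt (torsionBy R M y) i)
    (hQ : ∀ i, 𝔞.FiniteExt (M ⧸ LinearMap.range (LinearMap.lsmul R M y)) i) (i : ℕ) :
    𝔞.FiniteExt M i := by
  cases i with
  | zero =>
    have := hK 0
    rw [Ideal.FiniteExt.zero_iff] at this ⊢
    refine Module.Finite.of_injective (LinearMap.codRestrict (torsionBySet R (torsionBy R M y) 𝔞)
      ((torsionBySet R M 𝔞).subtype.codRestrict (torsionBy R M y) fun x ↦ ?_) fun x ↦ ?_)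
      fun a b h ↦ Subtype.ext ?_
    · exact (mem_torsionBySet_iff _ _).1 x.2 ⟨y, hy⟩
    · refine (mem_torsionBySet_iff _ _).2 fun a ↦ Subtype.ext ?_
      exact (mem_torsionBySet_iff _ _).1 x.2 a
    · exact congrArg (fun v : torsionBySet R (torsionBy R M y) 𝔞 ↦ (v : M)) h
  | succ i =>
    let U := LinearMap.range (LinearMap.lsmul R M y)
    have hS := LinearMap.shortExact_of_exact (Submodule.injective_subtype _)
      (LinearMap.surjective_rangeRestrict _)
      (LinearMap.exact_torsionBy_subtype_rangeRestrict_lsmul M y)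
    have hS' := LinearMap.shortExact_of_exact U.injective_subtype U.mkQ_surjective
      (LinearMap.exact_subtype_mkQ U)
    have hK := hK (i + 1)
    have hQ := hQ i
    rw [Ideal.FiniteExt] at hK hQ ⊢
    let X := ModuleCat.of R (R ⧸ 𝔞)
    let δ := hS'.extClass.postcompOfLinear R X (rfl : i + 1 = i + 1)
    have h : Function.Exact δ
        ((Abelian.Ext.mk₀ (ModuleCat.ofHom U.subtype)).postcompOfLinear R X (add_zero (i + 1))) :=
      (ShortComplex.ab_exact_iff_function_exact _).1
        (Abelian.Ext.covariant_sequence_exact₁' X hS' i (i + 1) rfl)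
    let g := (Abelian.Ext.mk₀
      (ModuleCat.ofHom (LinearMap.lsmul R M y).rangeRestrict)).postcompOfLinear
      R X (add_zero (i + 1))
    have h' : Function.Exact
        ((Abelian.Ext.mk₀ (ModuleCat.ofHom (torsionBy R M y).subtype)).postcompOfLinear
          R X (add_zero (i + 1))) g :=
      (ShortComplex.ab_exact_iff_function_exact _).1
        (Abelian.Ext.covariant_sequence_exact₂' X hS (i + 1))
    have hg (x) : g x ∈ LinearMap.range δ := by
      refine (h _).1 ?_
      simp only [g, Abelian.Ext.bilinearCompOfLinear_apply_apply, LinearMap.flip_apply,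
        Abelian.Ext.comp_assoc_of_third_deg_zero, Abelian.Ext.mk₀_comp_mk₀]
      have h1 : ModuleCat.ofHom (LinearMap.lsmul R M y).rangeRestrict ≫ ModuleCat.ofHom U.subtype =
          y • 𝟙 (ModuleCat.of R M) := rfl
      have hann : y ∈ Module.annihilator R X := (Ideal.annihilator_quotient (I := 𝔞)).symm ▸ hy
      rw [h1]
      exact DFunLike.congr_fun (congrArg AddCommGrpCat.Hom.hom
        (Abelian.Ext.postcomp_smul_id_eq_zero_of_mem_annihilator hann (i + 1))) x
    have hex : Function.Exact
        ((Abelian.Ext.mk₀ (ModuleCat.ofHom (torsionBy R M y).subtype)).postcompOfLinear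
          R X (add_zero (i + 1))) (g.codRestrict _ hg) := fun x ↦ by
      rw [← h' x]
      exact Subtype.ext_iff
    exact Module.Finite.of_function_exact hex

end

variable [IsNoetherianRing R]

/-- Finiteness of all `Ext^i(R/𝔞, M)` by Noetherian induction on an ideal annihilating `M`: for a
class of modules stable under passing to `torsionBy y` and `y • M`, where the images of the powers
of `y` stabilize up to denominators in the sets of `T`, it suffices to treat `M / y • M` in the
stable situation. -/
theorem Ideal.FiniteExt.induction {H : ∀ (M : Type u) [AddCommGroup M] [Module R M], Prop}
    (T : Set (Set R))
    (zero : ∀ (M : Type u) [AddCommGroup M] [Module R M], H M → 𝔞.FiniteExt M 0)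
    (torsionBy : ∀ (M : Type u) [AddCommGroup M] [Module R M], H M → ∀ y ∈ 𝔞,
      H (torsionBy R M y))
    (range : ∀ (M : Type u) [AddCommGroup M] [Module R M], H M → ∀ y ∈ 𝔞,
      (∀ i, 𝔞.FiniteExt (Submodule.torsionBy R M y) i) →
      H (LinearMap.range (LinearMap.lsmul R M y)))
    (stabilizes : ∀ (M : Type u) [AddCommGroup M] [Module R M], H M → ∀ y ∈ 𝔞,
      ∃ N, ∀ t ∈ T, ∀ m : M, ∃ s ∈ t, ∃ m' : M, s • y ^ N • m = y ^ (N + 1) • m')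
    (quotient : ∀ (M : Type u) [AddCommGroup M] [Module R M], H M → ∀ y ∈ 𝔞,
      (∀ i, 𝔞.FiniteExt (Submodule.torsionBy R M y) i) →
      (∀ t ∈ T, ∀ m : M, ∃ s ∈ t, ∃ m' : M, s • m = y • m') →
      ∀ i, 𝔞.FiniteExt (M ⧸ LinearMap.range (LinearMap.lsmul R M y)) i)
    (M : Type u) [AddCommGroup M] [Module R M] (hM : H M) (i : ℕ) : 𝔞.FiniteExt M i := by
  suffices ∀ (c : Ideal R) (M : Type u) [AddCommGroup M] [Module R M], H M →
      (∀ a ∈ c, ∀ m : M, a • m = 0) → ∀ i, 𝔞.FiniteExt M i from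
    this ⊥ M hM (fun a ha m ↦ by rw [(Submodule.mem_bot R).1 ha, zero_smul]) i
  intro c
  induction c using IsNoetherian.induction with
  | hgt c ih =>
    intro M _ _ hM hc i
    by_cases hac : 𝔞 ≤ c
    · have := Ideal.FiniteExt.zero_iff.1 (zero M hM)
      have htop : torsionBySet R M 𝔞 = ⊤ := eq_top_iff.2 fun m _ ↦
        (mem_torsionBySet_iff _ _).2 fun a ↦ hc a (hac a.2) m
      have : Module.Finite R M := Module.Finite.equiv (LinearEquiv.ofTop _ htop)
      exact .of_finite i
    · obtain ⟨y, hy, hyc⟩ := SetLike.not_le_iff_exists.1 hac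
      have hlt : c < c ⊔ span {y} := left_lt_sup.2 fun h ↦ hyc (h (Ideal.subset_span rfl))
      have hK (M : Type u) [AddCommGroup M] [Module R M] (hM : H M)
          (hc : ∀ a ∈ c, ∀ m : M, a • m = 0) : ∀ i, 𝔞.FiniteExt (Submodule.torsionBy R M y) i := by
        refine ih _ hlt _ (torsionBy M hM y hy) ?_
        have hle : c ⊔ span {y} ≤ Module.annihilator R (Submodule.torsionBy R M y) := by
          refine sup_le (fun a ha ↦ ?_) ((Ideal.span_singleton_le_iff_mem _).2 ?_)
          · exact Module.mem_annihilator.2 fun m ↦ Subtype.ext (hc a ha m)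
          · exact Module.mem_annihilator.2 fun m ↦ Subtype.ext m.2
        exact fun a ha ↦ Module.mem_annihilator.1 (hle ha)
      obtain ⟨N, hN⟩ := stabilizes M hM y hy
      induction N generalizing M i with
      | zero =>
        refine .of_quotient_range_lsmul hy (hK M hM hc) (quotient M hM y hy (hK M hM hc) ?_) i
        simpa using hN
      | succ N ihN =>
        refine .of_range_lsmul (hK M hM hc i) (ihN _ (range M hM y hy (hK M hM hc)) ?_ i ?_)
        · exact fun a ha m ↦ Subtype.ext (hc a ha m)
        · rintro t ht ⟨_, m, rfl⟩
          obtain ⟨s, hs, m', hm⟩ := hN t ht m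
          refine ⟨s, hs, ⟨_, m', rfl⟩, Subtype.ext ?_⟩
          simpa [← mul_smul, pow_succ, mul_assoc] using hm

/-- An Artinian module `M` such that `Hom(R/𝔞, M)` is finitely generated is `𝔞`-cofinite. -/
theorem Ideal.FiniteExt.of_isArtinian (M : Type u) [AddCommGroup M] [Module R M] [IsArtinian R M]
    (h : 𝔞.FiniteExt M 0) (i : ℕ) : 𝔞.FiniteExt M i := by
  refine Ideal.FiniteExt.induction (H := fun M ↦ IsArtinian R M ∧ 𝔞.FiniteExt M 0) {{1}}
    (fun M _ _ h ↦ h.2) (fun M _ _ h y hy ↦ ?_) (fun M _ _ h y hy _ ↦ ?_) (fun M _ _ h y hy ↦ ?_)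
    (fun M _ _ h y hy _ hT ↦ ?_) M ⟨inferInstance, h⟩ i
  · have := h.1
    exact ⟨inferInstance, .left_zero (Submodule.injective_subtype _) h.2⟩
  · have := h.1
    exact ⟨inferInstance, .left_zero (Submodule.injective_subtype _) h.2⟩
  · have := h.1
    obtain ⟨N, hN⟩ := IsArtinian.range_smul_pow_stabilizes (R := R) M y
    refine ⟨N, ?_⟩
    rintro _ rfl m
    obtain ⟨m', hm'⟩ : y ^ N • m ∈ LinearMap.range (y ^ (N + 1) • (LinearMap.id : M →ₗ[R] M)) :=
      hN (N + 1) (by lia) ▸ ⟨m, rfl⟩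
    exact ⟨1, rfl, m', by rw [one_smul]; exact hm'.symm⟩
  · have htop : LinearMap.range (LinearMap.lsmul R M y) = ⊤ := by
      refine eq_top_iff.2 fun m _ ↦ ?_
      obtain ⟨_, rfl, m', hm'⟩ := hT _ rfl m
      exact ⟨m', by rw [LinearMap.lsmul_apply, ← hm', one_smul]⟩
    rw [htop]
    exact .of_finite

/-- If `dim R/𝔞 ≤ 1`, an `𝔞`-torsion module `M` for which `Hom(R/𝔞, M)` and `Ext^1(R/𝔞, M)` are
finitely generated is `𝔞`-cofinite. -/
theorem Ideal.FiniteExt.of_zero_of_one (hdim : ringKrullDim (R ⧸ 𝔞) ≤ 1) (M : Type u)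
    [AddCommGroup M] [Module R M] (hM : 𝔞.powTorsion M = ⊤) (h0 : 𝔞.FiniteExt M 0)
    (h1 : 𝔞.FiniteExt M 1) (i : ℕ) : 𝔞.FiniteExt M i := by
  refine Ideal.FiniteExt.induction
    (H := fun M ↦ 𝔞.powTorsion M = ⊤ ∧ 𝔞.FiniteExt M 0 ∧ 𝔞.FiniteExt M 1)
    ((fun p : Ideal R ↦ (p : Set R)ᶜ) '' 𝔞.minimalPrimes)
    (fun M _ _ h ↦ h.2.1) (fun M _ _ h y hy ↦ ?_) (fun M _ _ h y hy hK ↦ ?_)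
    (fun M _ _ h y hy ↦ ?_) (fun M _ _ h y hy hK hT ↦ ?_) M ⟨hM, h0, h1⟩ i
  · refine ⟨Ideal.powTorsion_eq_top_of_injective (Submodule.injective_subtype _) h.1,
      .left_zero (Submodule.injective_subtype _) h.2.1, ?_⟩
    exact .left (Submodule.injective_subtype _) (LinearMap.surjective_rangeRestrict _)
      (LinearMap.exact_torsionBy_subtype_rangeRestrict_lsmul M y)
      (.left_zero (Submodule.injective_subtype _) h.2.1) h.2.2
  · refine ⟨Ideal.powTorsion_eq_top_of_injective (Submodule.injective_subtype _) h.1,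
      .left_zero (Submodule.injective_subtype _) h.2.1, ?_⟩
    exact .right (Submodule.injective_subtype _) (LinearMap.surjective_rangeRestrict _)
      (LinearMap.exact_torsionBy_subtype_rangeRestrict_lsmul M y) h.2.2 (hK 2)
  · have := Ideal.FiniteExt.zero_iff.1 h.2.1
    have hp (p : Ideal R) : ∃ N, p ∈ 𝔞.minimalPrimes → ∀ n, N ≤ n → ∀ m : M, ∃ s ∉ p, ∃ m' : M,
        s • y ^ n • m = y ^ (n + 1) • m' := by
      by_cases hp : p ∈ 𝔞.minimalPrimes
      · have := hp.1.1
        obtain ⟨N, hN⟩ := exists_forall_smul_pow_eq hp h.1 y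
        exact ⟨N, fun _ ↦ hN⟩
      · exact ⟨0, fun h ↦ (hp h).elim⟩
    choose N hN using hp
    obtain ⟨B, hB⟩ := ((𝔞.finite_minimalPrimes_of_isNoetherianRing R).image N).bddAbove
    refine ⟨B, ?_⟩
    rintro _ ⟨p, hp, rfl⟩
    exact hN p hp B (hB ⟨p, hp, rfl⟩)
  · set U := LinearMap.range (LinearMap.lsmul R M y)
    have hU : 𝔞.FiniteExt U 1 :=
      .right (Submodule.injective_subtype _) (LinearMap.surjective_rangeRestrict _)
        (LinearMap.exact_torsionBy_subtype_rangeRestrict_lsmul M y) h.2.2 (hK 2)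
    have hQ : 𝔞.FiniteExt (M ⧸ U) 0 :=
      .right U.injective_subtype U.mkQ_surjective (LinearMap.exact_subtype_mkQ U) h.2.1 hU
    have hfin := Ideal.FiniteExt.zero_iff.1 hQ
    have hart : IsArtinian R (torsionBySet R (M ⧸ U) 𝔞) := by
      refine isArtinian_of_forall_isMaximal
        (I := Module.annihilator R (torsionBySet R (M ⧸ U) 𝔞)) (fun q hq hle ↦ ?_)
        fun a ha ↦ Module.mem_annihilator.1 ha
      have haq : 𝔞 ≤ q := fun a ha ↦ hle <| Module.mem_annihilator.2 fun m ↦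
        Subtype.ext ((mem_torsionBySet_iff _ _).1 m.2 ⟨a, ha⟩)
      refine (Ideal.mem_minimalPrimes_or_isMaximal hdim haq).resolve_left fun hmin ↦ ?_
      have hsupp : ⟨q, hq⟩ ∈ Module.support R (torsionBySet R (M ⧸ U) 𝔞) := by
        rw [Module.support_eq_zeroLocus]
        exact hle
      refine Module.notMem_support_iff'.2 ?_ hsupp
      rintro ⟨m, hm⟩
      obtain ⟨m, rfl⟩ := U.mkQ_surjective m
      obtain ⟨s, hs, m', hm'⟩ := hT _ ⟨q, hmin, rfl⟩ m
      refine ⟨s, hs, Subtype.ext ?_⟩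
      change U.mkQ (s • m) = 0
      rw [Submodule.mkQ_apply, Submodule.Quotient.mk_eq_zero, hm']
      exact ⟨m', rfl⟩
    obtain ⟨t, ht⟩ := IsNoetherian.noetherian 𝔞
    have ht' : Ideal.span (t : Set R) = 𝔞 := ht
    have hart' : IsArtinian R (torsionBySet R (M ⧸ U) (t : Set R)) := by
      rw [torsionBySet_eq_torsionBySet_span, ht']
      exact hart
    have := isArtinian_of_torsionBySet (M := M ⧸ U) t.finite_toSet fun a ha m ↦ by
      obtain ⟨n, hn⟩ : m ∈ 𝔞.powTorsion (M ⧸ U) :=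
        Ideal.powTorsion_eq_top_of_surjective U.mkQ_surjective h.1 ▸ mem_top
      exact ⟨n, hn _ (Ideal.pow_mem_pow (ht' ▸ Ideal.subset_span ha) n)⟩
    exact .of_isArtinian _ hQ

end

section

variable {R : Type u} [CommRing R] {𝔞 : Ideal R}

lemma Ideal.support_subset_zeroLocus_of_powTorsion_eq_top {M : Type u} [AddCommGroup M]
    [Module R M] (h : 𝔞.powTorsion M = ⊤) :
    Module.support R M ⊆ PrimeSpectrum.zeroLocus (𝔞 : Set R) := by
  intro p hp a ha
  by_contra hap
  refine Module.notMem_support_iff'.2 (fun m ↦ ?_) hp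
  obtain ⟨n, hn⟩ : m ∈ 𝔞.powTorsion M := h ▸ Submodule.mem_top
  exact ⟨a ^ n, fun h ↦ hap (p.2.mem_of_pow_mem n h), hn _ (Ideal.pow_mem_pow ha n)⟩

lemma IsCofinite.congr {M N : Type u} [AddCommGroup M] [Module R M]
    [AddCommGroup N] [Module R N] (e : M ≃ₗ[R] N) (h : IsCofinite R 𝔞 M) : IsCofinite R 𝔞 N :=
  ⟨e.support_eq ▸ h.1, fun i ↦ extModule_finite_iff.2 ((extModule_finite_iff.1 (h.2 i)).congr e)⟩

lemma isCofinite_localCohomologyModule_iff {M : Type u} [AddCommGroup M] [Module R M] {i : ℕ}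
    {N : Type u} [AddCommGroup N] [Module R N]
    (h : Nonempty (localCohomology.ExtLimit 𝔞 (ModuleCat.of R M) i ≃ₗ[R] N)) :
    IsCofinite R 𝔞 (localCohomologyModule R 𝔞 M i) ↔ IsCofinite R 𝔞 N := by
  obtain ⟨e⟩ := localCohomology.nonempty_extLimit_equiv 𝔞 (ModuleCat.of R M) i
  obtain ⟨e'⟩ := h
  exact ⟨.congr (e.symm.trans e'), .congr (e'.symm.trans e)⟩

variable [IsNoetherianRing R]

lemma Ideal.finiteExt_zero_quotient_powTorsion (M : Type u) [AddCommGroup M] [Module R M] :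
    𝔞.FiniteExt (M ⧸ 𝔞.powTorsion M) 0 := by
  rw [Ideal.FiniteExt.zero_iff]
  have hle : Submodule.torsionBySet R (M ⧸ 𝔞.powTorsion M) 𝔞 ≤ 𝔞.powTorsion _ := fun m hm ↦
    ⟨1, fun a ha ↦ (Submodule.mem_torsionBySet_iff _ _).1 hm ⟨a, by simpa using ha⟩⟩
  rw [Ideal.powTorsion_quotient_eq_bot, le_bot_iff] at hle
  rw [hle]
  infer_instance

lemma Ideal.FiniteExt.powTorsion (hdim : ringKrullDim (R ⧸ 𝔞) ≤ 1) {M : Type u} [AddCommGroup M]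
    [Module R M] (h : ∀ i, 𝔞.FiniteExt M i) (i : ℕ) : 𝔞.FiniteExt (𝔞.powTorsion M) i :=
  .of_zero_of_one hdim _ Ideal.powTorsion_powTorsion
    (.left_zero (Submodule.injective_subtype _) (h 0))
    (.left (Submodule.injective_subtype _) (Submodule.mkQ_surjective _)
      (LinearMap.exact_subtype_mkQ _) (Ideal.finiteExt_zero_quotient_powTorsion M) (h 1)) i

lemma isCofinite_localCohomologyModule_of_finiteExt (hdim : ringKrullDim (R ⧸ 𝔞) ≤ 1) (i : ℕ)
    {M : Type u} [AddCommGroup M] [Module R M] (h : ∀ i, 𝔞.FiniteExt M i) :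
    IsCofinite R 𝔞 (localCohomologyModule R 𝔞 M i) := by
  have hΓ := Ideal.FiniteExt.powTorsion hdim h
  induction i generalizing M with
  | zero =>
    rw [isCofinite_localCohomologyModule_iff (localCohomology.nonempty_extLimit_zero_equiv M)]
    exact ⟨Ideal.support_subset_zeroLocus_of_powTorsion_eq_top Ideal.powTorsion_powTorsion,
      fun i ↦ extModule_finite_iff.2 (hΓ i)⟩
  | succ i ih =>
    obtain ⟨D, _, _, hD, hDF⟩ := localCohomology.exists_shift M 𝔞
    obtain ⟨e⟩ := hD i
    obtain ⟨e'⟩ := localCohomology.nonempty_extLimit_equiv 𝔞 (ModuleCat.of R D) i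
    rw [isCofinite_localCohomologyModule_iff (N := localCohomologyModule R 𝔞 D i)
      ⟨e.trans e'⟩]
    have hD (i : ℕ) : 𝔞.FiniteExt D i := (hDF i).2 <|
      .right (Submodule.injective_subtype _) (Submodule.mkQ_surjective _)
        (LinearMap.exact_subtype_mkQ _) (h _) (hΓ _)
    exact ih hD (Ideal.FiniteExt.powTorsion hdim hD)

lemma finiteExt_of_isCofinite_localCohomologyModule (j : ℕ) {M : Type u} [AddCommGroup M]
    [Module R M] (h : ∀ i, IsCofinite R 𝔞 (localCohomologyModule R 𝔞 M i)) :
    𝔞.FiniteExt M j := by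
  have hΓ : 𝔞.FiniteExt (𝔞.powTorsion M) j := extModule_finite_iff.1 <|
    ((isCofinite_localCohomologyModule_iff
      (localCohomology.nonempty_extLimit_zero_equiv M)).1 (h 0)).2 j
  refine hΓ.middle (Submodule.injective_subtype _) (Submodule.mkQ_surjective _)
    (LinearMap.exact_subtype_mkQ _) ?_
  induction j generalizing M with
  | zero => exact Ideal.finiteExt_zero_quotient_powTorsion M
  | succ j ih =>
    obtain ⟨D, _, _, hD, hDF⟩ := localCohomology.exists_shift M 𝔞
    have h' (i : ℕ) : IsCofinite R 𝔞 (localCohomologyModule R 𝔞 D i) := by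
      obtain ⟨e⟩ := hD i
      obtain ⟨e'⟩ := localCohomology.nonempty_extLimit_equiv 𝔞 (ModuleCat.of R D) i
      exact (isCofinite_localCohomologyModule_iff ⟨e.trans e'⟩).1 (h (i + 1))
    have hΓ : 𝔞.FiniteExt (𝔞.powTorsion D) j := extModule_finite_iff.1 <|
      ((isCofinite_localCohomologyModule_iff
        (localCohomology.nonempty_extLimit_zero_equiv D)).1 (h' 0)).2 j
    exact (hDF j).1 (hΓ.middle (Submodule.injective_subtype _) (Submodule.mkQ_surjective _)
      (LinearMap.exact_subtype_mkQ _) (ih h' hΓ))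

end

/-- Theorem 3.4, case (b): if `dim R/𝔞 ≤ 1`, then all `H^i_𝔞(M)` are `𝔞`-cofinite iff all
`Ext^i_R(R/𝔞, M)` are finitely generated. -/
theorem localCohomology_isCofinite_iff_ext_finite_of_dim_quot_le_one
    (R : Type u) [CommRing R] [IsNoetherianRing R] (𝔞 : Ideal R)
    (hdim : ringKrullDim (R ⧸ 𝔞) ≤ 1)
    (M : Type u) [AddCommGroup M] [Module R M] :
    (∀ i : ℕ, IsCofinite R 𝔞 (localCohomologyModule R 𝔞 M i)) ↔
      (∀ i : ℕ, Module.Finite R (extModule R (R ⧸ 𝔞) M i)) :=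
  ⟨fun h i ↦ extModule_finite_iff.2 (finiteExt_of_isCofinite_localCohomologyModule i h),
    fun h i ↦ isCofinite_localCohomologyModule_of_finiteExt hdim i
      fun i ↦ extModule_finite_iff.1 (h i)⟩
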